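/- arXiv:2412.14091 — 8 statements merged into one kernel-verified Lean document; each statement's English description precedes it below -/
import Mathlib

section
/- Let k ≥ 1 and n = 2k. The ideal I_{k,2k} of the polynomial ring R = ℂ[x_K : K a k-element subset of {1,…,2k}] generated by all Grassmann–Plücker polynomials G_{I,J} and all orthogonality polynomials H_{I,J} is NOT a prime ideal. -/
/-- The Plücker variable `x_K` of the polynomial ring `ℂ[x_K : K ∈ C([n],k)]`,
extended by `0` to index sets of the wrong cardinality. -/
noncomputable def Xv (n k : ℕ) (K : Finset (Fin n)) :
    MvPolynomial {K : Finset (Fin n) // K.card = k} ℂ :=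
  if h : K.card = k then MvPolynomial.X ⟨K, h⟩ else 0

/-- The Grassmann–Plücker polynomial `G_{I,J}` for a `(k-1)`-set `I` and a
`(k+1)`-set `J`:
`G_{I,J} = ∑_{j ∈ J∖I} (-1)^{#{j' ∈ J : j' ≤ j} + #{i ∈ I : i > j}} x_{I∪{j}} x_{J∖{j}}`. -/
noncomputable def GP (n k : ℕ) (I J : Finset (Fin n)) :
    MvPolynomial {K : Finset (Fin n) // K.card = k} ℂ :=
  ∑ j ∈ J \ I,
    ((-1 : MvPolynomial {K : Finset (Fin n) // K.card = k} ℂ) ^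
        ((J.filter fun j' => j' ≤ j).card + (I.filter fun i => j < i).card)) *
      Xv n k (insert j I) * Xv n k (J.erase j)

/-- The orthogonality polynomial `H_{I,J}` for `(k-1)`-sets `I, J`:
`H_{I,J} = ∑_{ℓ ∉ I∪J} (-1)^{#{i ∈ I : i > ℓ} + #{j ∈ J : j > ℓ}} x_{I∪{ℓ}} x_{J∪{ℓ}}`. -/
noncomputable def HO (n k : ℕ) (I J : Finset (Fin n)) :
    MvPolynomial {K : Finset (Fin n) // K.card = k} ℂ :=
  ∑ l ∈ (I ∪ J)ᶜ,
    ((-1 : MvPolynomial {K : Finset (Fin n) // K.card = k} ℂ) ^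
        ((I.filter fun i => l < i).card + (J.filter fun j => l < j).card)) *
      Xv n k (insert l I) * Xv n k (insert l J)

/-- The ideal `I_{k,n}` generated by all the Grassmann–Plücker polynomials `G_{I,J}`
and all the orthogonality polynomials `H_{I,J}`; it cuts out the orthogonal
Grassmannian `OGr(k,n)` in the Plücker embedding. -/
noncomputable def Ikn (n k : ℕ) :
    Ideal (MvPolynomial {K : Finset (Fin n) // K.card = k} ℂ) :=
  Ideal.span
    ({f | ∃ I J : Finset (Fin n), I.card = k - 1 ∧ J.card = k + 1 ∧ f = GP n k I J} ∪
     {f | ∃ I J : Finset (Fin n), I.card = k - 1 ∧ J.card = k - 1 ∧ f = HO n k I J})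

namespace OrthogonalPlucker

open Finset

/-- The index `i` of the first half of `{0, …, 2k - 1}`. -/
def lo {k : ℕ} (i : Fin k) : Fin (2 * k) := ⟨i, by omega⟩

/-- The index `k + t` of the second half of `{0, …, 2k - 1}`. -/
def hi {k : ℕ} : Fin k ↪ Fin (2 * k) :=
  ⟨fun t => ⟨k + t, by omega⟩, fun a b h => by
    simp only [Fin.mk.injEq] at h
    exact Fin.ext (by omega)⟩

@[simp] lemma val_lo {k : ℕ} (i : Fin k) : (lo i).val = i := rfl

@[simp] lemma val_hi {k : ℕ} (t : Fin k) : (hi t).val = k + t := rfl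

/-- The set `{r, …, k - 1} ∪ (k + T)`. -/
def tailUnion {k : ℕ} (r : ℕ) (T : Finset (Fin k)) : Finset (Fin (2 * k)) :=
  (univ.filter fun m : Fin (2 * k) => r ≤ m.val ∧ m.val < k) ∪ T.map hi

lemma mem_tailUnion {k r : ℕ} {T : Finset (Fin k)} {m : Fin (2 * k)} :
    m ∈ tailUnion r T ↔ (r ≤ m.val ∧ m.val < k) ∨ ∃ t ∈ T, k + t.val = m.val := by
  simp [tailUnion, Fin.ext_iff]

lemma lo_mem_tailUnion {k r : ℕ} {T : Finset (Fin k)} {i : Fin k} :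
    lo i ∈ tailUnion r T ↔ r ≤ i.val := by
  rw [mem_tailUnion]
  simp only [lo]
  constructor
  · rintro (h | ⟨t, -, h⟩) <;> omega
  · exact fun h => Or.inl ⟨h, i.2⟩

lemma hi_mem_tailUnion {k r : ℕ} {T : Finset (Fin k)} {t : Fin k} :
    hi t ∈ tailUnion r T ↔ t ∈ T := by
  rw [mem_tailUnion]
  simp only [val_hi]
  constructor
  · rintro (h | ⟨s, hs, h⟩)
    · omega
    · rwa [show t = s from Fin.ext (by omega)]
  · exact fun h => Or.inr ⟨t, h, rfl⟩

lemma eq_lo_or_eq_hi {k : ℕ} (m : Fin (2 * k)) : (∃ i : Fin k, m = lo i) ∨ ∃ t : Fin k, m = hi t := by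
  by_cases h : m.val < k
  · exact Or.inl ⟨⟨m, h⟩, rfl⟩
  · refine Or.inr ⟨⟨m - k, by omega⟩, Fin.ext ?_⟩
    simp only [val_hi]
    omega

lemma ext_halves {k : ℕ} {K L : Finset (Fin (2 * k))} (h₁ : ∀ i : Fin k, lo i ∈ K ↔ lo i ∈ L)
    (h₂ : ∀ t : Fin k, hi t ∈ K ↔ hi t ∈ L) : K = L := by
  ext m
  rcases eq_lo_or_eq_hi m with ⟨i, rfl⟩ | ⟨t, rfl⟩
  · exact h₁ i
  · exact h₂ t

lemma card_tailUnion {k : ℕ} (r : ℕ) (T : Finset (Fin k)) :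
    (tailUnion r T).card = (k - r) + T.card := by
  rw [tailUnion, card_union_of_disjoint, card_map, ← Nat.card_Ico r k]
  · congr 1
    rw [← card_map Fin.valEmbedding]
    congr 1
    ext m
    simp only [mem_map, mem_filter, mem_univ, true_and, Fin.valEmbedding_apply, mem_Ico]
    exact ⟨by rintro ⟨a, h, rfl⟩; exact h, fun h => ⟨⟨m, by omega⟩, h, rfl⟩⟩
  · rw [Finset.disjoint_left]
    intro m hm hm'
    simp only [mem_filter, mem_univ, true_and, mem_map] at hm hm'
    obtain ⟨t, -, rfl⟩ := hm'
    simp at hm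

@[simp] lemma lo_inj {k : ℕ} {i j : Fin k} : lo i = lo j ↔ i = j := by
  simp [lo, Fin.ext_iff]

@[simp] lemma lo_ne_hi {k : ℕ} {i t : Fin k} : lo i ≠ hi t := by
  simp only [ne_eq, Fin.ext_iff, val_lo, val_hi]
  omega

@[simp] lemma hi_ne_lo {k : ℕ} {i t : Fin k} : hi t ≠ lo i := lo_ne_hi.symm

@[simp] lemma lo_le_lo {k : ℕ} {i j : Fin k} : lo i ≤ lo j ↔ i ≤ j := Iff.rfl

@[simp] lemma lo_lt_hi {k : ℕ} {i t : Fin k} : lo i < hi t := by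
  simp only [Fin.lt_def, val_lo, val_hi]
  omega

@[simp] lemma hi_le_hi {k : ℕ} {s t : Fin k} : hi s ≤ hi t ↔ s ≤ t := by
  rw [Fin.le_def, Fin.le_def, val_hi, val_hi, Nat.add_le_add_iff_left]

section Relations

variable {k : ℕ} {A : Type*} [CommRing A]
  (φ : MvPolynomial {K : Finset (Fin (2 * k)) // K.card = k} ℂ →+* A)

/-- The image of the variable indexed by `{0, …, k - 1} ∖ {i} ∪ {k + t}`. -/
noncomputable def exchange (i t : Fin k) : A :=
  φ (Xv (2 * k) k (insert (hi t) ((tailUnion 0 ∅).erase (lo i))))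

/-- A Grassmann–Plücker relation in the form of a Laplace expansion. -/
lemma laplace_relation (hφ : ∀ I J : Finset (Fin (2 * k)), I.card = k - 1 → J.card = k + 1 →
      φ (GP (2 * k) k I J) = 0) (r : Fin k) (T : Finset (Fin k)) (hT : T.card = r + 1) :
    φ (Xv (2 * k) k (tailUnion 0 ∅)) * φ (Xv (2 * k) k (tailUnion (r + 1) T)) =
      ∑ t ∈ T, (-1) ^ (T.filter (· < t)).card * exchange φ r t *
        φ (Xv (2 * k) k (tailUnion r (T.erase t))) := by
  have hI : ((tailUnion 0 ∅).erase (lo r)).card = k - 1 := by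
    rw [card_erase_of_mem (lo_mem_tailUnion.2 (Nat.zero_le _)), card_tailUnion]
    simp
  have h := hφ ((tailUnion 0 ∅).erase (lo r)) (tailUnion r T) hI (by
    rw [card_tailUnion, hT]; omega)
  have hdiff : tailUnion r T \ (tailUnion 0 ∅).erase (lo r) = insert (lo r) (T.map hi) := by
    apply ext_halves <;> intro i
    · simp [lo_mem_tailUnion]
      rintro rfl
      exact le_rfl
    · simp [hi_mem_tailUnion]
  rw [GP, hdiff, sum_insert (by simp), sum_map] at h
  have c1 : ((tailUnion r T).filter fun j' => j' ≤ lo r) = {lo r} := by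
    apply ext_halves <;> intro i
    · simp only [mem_filter, lo_mem_tailUnion, lo_le_lo, mem_singleton, lo_inj]
      exact ⟨fun h => le_antisymm h.2 h.1, by rintro rfl; simp⟩
    · simp [hi_mem_tailUnion, lo_lt_hi]
  have c2 : (((tailUnion 0 ∅).erase (lo r)).filter fun i => lo r < i) =
      tailUnion (r + 1) ∅ := by
    apply ext_halves <;> intro i
    · simp only [mem_filter, mem_erase, lo_mem_tailUnion, ne_eq, Fin.lt_def,
        Fin.ext_iff, val_lo]
      omega
    · simp [hi_mem_tailUnion]
  have c3 (t : Fin k) : ((tailUnion r T).filter fun j' => j' ≤ hi t) =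
      tailUnion r (T.filter (· ≤ t)) := by
    apply ext_halves <;> intro i
    · simp [lo_mem_tailUnion, lo_lt_hi.le]
    · simp [hi_mem_tailUnion]
  have c4 (t : Fin k) : (((tailUnion 0 ∅).erase (lo r)).filter fun i => hi t < i) = ∅ := by
    apply ext_halves <;> intro i
    · simp [lo_lt_hi.le]
    · simp [hi_mem_tailUnion]
  have e1 : insert (lo r) ((tailUnion 0 ∅).erase (lo r)) = tailUnion 0 ∅ :=
    insert_erase (lo_mem_tailUnion.2 (Nat.zero_le _))
  have e2 : (tailUnion r T).erase (lo r) = tailUnion (r + 1) T := by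
    apply ext_halves <;> intro i
    · simp only [mem_erase, lo_mem_tailUnion, ne_eq, Fin.ext_iff, val_lo]
      omega
    · simp [hi_mem_tailUnion]
  have e3 (t : Fin k) : (tailUnion r T).erase (hi t) = tailUnion r (T.erase t) := by
    apply ext_halves <;> intro i
    · simp [lo_mem_tailUnion]
    · simp [hi_mem_tailUnion]
  have c5 (t : Fin k) (ht : t ∈ T) :
      (T.filter (· ≤ t)).card = (T.filter (· < t)).card + 1 := by
    rw [← card_insert_of_notMem (s := T.filter (· < t)) (a := t) (by simp)]
    congr 1
    ext s
    simp only [mem_filter, mem_insert]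
    grind
  simp only [c1, c2, c3, c4, e1, e2, e3, card_tailUnion, card_singleton, card_empty, add_zero,
    map_add, map_mul, map_sum, map_pow, map_neg, map_one] at h
  have hs : ((-1 : A) ^ (k - r.val)) * (-1) ^ (k - r.val) = 1 := by
    rw [← mul_pow]; simp
  rw [show 1 + (k - (r.val + 1)) = k - r.val by omega] at h
  have h' : (-1 : A) ^ (k - r.val) * (φ (Xv (2 * k) k (tailUnion 0 ∅)) *
      φ (Xv (2 * k) k (tailUnion (r + 1) T)) -
      ∑ t ∈ T, (-1) ^ (T.filter (· < t)).card * exchange φ r t *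
        φ (Xv (2 * k) k (tailUnion r (T.erase t)))) = 0 := by
    rw [← h, mul_sub, mul_sum, sub_eq_add_neg, ← sum_neg_distrib, mul_assoc]
    congr 1
    refine sum_congr rfl fun t ht => ?_
    rw [c5 t ht, exchange]
    ring
  calc _ = (-1 : A) ^ (k - r.val) * (-1) ^ (k - r.val) * (φ (Xv (2 * k) k (tailUnion 0 ∅)) *
      φ (Xv (2 * k) k (tailUnion (r + 1) T)) -
      ∑ t ∈ T, (-1) ^ (T.filter (· < t)).card * exchange φ r t *
        φ (Xv (2 * k) k (tailUnion r (T.erase t)))) +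
      ∑ t ∈ T, (-1) ^ (T.filter (· < t)).card * exchange φ r t *
        φ (Xv (2 * k) k (tailUnion r (T.erase t))) := by rw [hs]; ring
    _ = _ := by rw [mul_assoc, h']; simp

/-- The exchange coordinates, with the sign `(-1) ^ i` in row `i`. -/
noncomputable def exchangeMatrix : Matrix (Fin k) (Fin k) A :=
  Matrix.of fun i t => (-1) ^ i.val * exchange φ i t

lemma sum_orderEmbOfFin {ι M : Type*} [LinearOrder ι] [AddCommMonoid M] {T : Finset ι} {r : ℕ}
    (hT : T.card = r) (f : ι → M) : ∑ t ∈ T, f t = ∑ j, f (T.orderEmbOfFin hT j) := by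
  conv_lhs => rw [← map_orderEmbOfFin_univ T hT, sum_map]
  rfl

/-- The Plücker coordinates are minors of the exchange matrix. -/
lemma coordinate_eq_minor (hφ : ∀ I J : Finset (Fin (2 * k)), I.card = k - 1 → J.card = k + 1 →
      φ (GP (2 * k) k I J) = 0) (r : ℕ) (hr : r ≤ k) (T : Finset (Fin k)) (hT : T.card = r) :
    φ (Xv (2 * k) k (tailUnion 0 ∅)) ^ r * φ (Xv (2 * k) k (tailUnion r T)) =
      φ (Xv (2 * k) k (tailUnion 0 ∅)) *
        ((exchangeMatrix φ).submatrix (Fin.castLE hr) (T.orderEmbOfFin hT)).det := by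
  induction r generalizing T with
  | zero =>
    obtain rfl := card_eq_zero.1 hT
    simp
  | succ r ih =>
    have h := laplace_relation φ hφ ⟨r, hr⟩ T hT
    simp only at h
    rw [pow_succ, mul_assoc, h, Matrix.det_succ_row _ (Fin.last r), mul_sum, mul_sum,
      sum_orderEmbOfFin hT]
    refine sum_congr rfl fun j _ => ?_
    have hmem : T.orderEmbOfFin hT j ∈ T := orderEmbOfFin_mem T hT j
    have hcard : (T.erase (T.orderEmbOfFin hT j)).card = r := by
      rw [card_erase_of_mem hmem, hT]; rfl
    have hlt : (T.filter (· < T.orderEmbOfFin hT j)).card = j := by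
      have : T.filter (· < T.orderEmbOfFin hT j) =
          (Iio j).map (T.orderEmbOfFin hT).toEmbedding := by
        ext s
        simp only [mem_filter, mem_map, mem_Iio]
        constructor
        · rintro ⟨hs, hlt⟩
          obtain ⟨i, rfl⟩ : s ∈ Set.range (T.orderEmbOfFin hT) := by
            rwa [range_orderEmbOfFin]
          exact ⟨i, by simpa using hlt, rfl⟩
        · rintro ⟨i, hi, rfl⟩
          exact ⟨orderEmbOfFin_mem T hT i, by simpa using hi⟩
      rw [this, card_map, Fin.card_Iio]
    have hsub : (fun i => T.orderEmbOfFin hT (j.succAbove i)) =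
        (T.erase (T.orderEmbOfFin hT j)).orderEmbOfFin hcard := by
      apply orderEmbOfFin_unique
      · intro i
        simp [Fin.succAbove_ne]
      · exact (T.orderEmbOfFin hT).strictMono.comp (Fin.strictMono_succAbove j)
    have ih' := ih (by omega) (T.erase (T.orderEmbOfFin hT j)) hcard
    have hdet : (((exchangeMatrix φ).submatrix (Fin.castLE hr) (T.orderEmbOfFin hT)).submatrix
        (Fin.last r).succAbove j.succAbove) =
        (exchangeMatrix φ).submatrix (Fin.castLE (Nat.le_of_succ_le hr))
          ((T.erase (T.orderEmbOfFin hT j)).orderEmbOfFin hcard) := by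
      rw [← hsub]
      ext a b
      simp [Matrix.submatrix_apply]
    have hlast : Fin.castLE hr (Fin.last r) = ⟨r, hr⟩ := rfl
    have hs : (-1 : A) ^ r * (-1) ^ r = 1 := by rw [← mul_pow]; simp
    have hentry : exchangeMatrix φ ⟨r, hr⟩ (T.orderEmbOfFin hT j) =
        (-1) ^ r * exchange φ ⟨r, hr⟩ (T.orderEmbOfFin hT j) := rfl
    rw [hdet, hlt, Matrix.submatrix_apply, hlast, hentry, Fin.val_last, pow_add]
    linear_combination ((-1) ^ j.val * exchange φ ⟨r, hr⟩ (T.orderEmbOfFin hT j)) * ih' -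
      (φ (Xv (2 * k) k (tailUnion 0 ∅)) * (-1) ^ j.val *
        exchange φ ⟨r, hr⟩ (T.orderEmbOfFin hT j) *
        ((exchangeMatrix φ).submatrix (Fin.castLE (Nat.le_of_succ_le hr))
          ((T.erase (T.orderEmbOfFin hT j)).orderEmbOfFin hcard)).det) * hs

/-- The orthogonality relations for the rows of the exchange coordinates. -/
lemma sum_exchange_mul_exchange (hφ : ∀ I J : Finset (Fin (2 * k)), I.card = k - 1 →
      J.card = k - 1 → φ (HO (2 * k) k I J) = 0) (i i' : Fin k) :
    ∑ t, exchange φ i t * exchange φ i' t =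
      if i = i' then -φ (Xv (2 * k) k (tailUnion 0 ∅)) ^ 2 else 0 := by
  have hI (i : Fin k) : ((tailUnion 0 ∅).erase (lo i)).card = k - 1 := by
    rw [card_erase_of_mem (lo_mem_tailUnion.2 (Nat.zero_le _)), card_tailUnion]
    simp
  have h := hφ _ _ (hI i) (hI i')
  have c (i t : Fin k) : (((tailUnion 0 ∅).erase (lo i)).filter fun j => hi t < j) = ∅ := by
    apply ext_halves <;> intro j
    · simp [lo_lt_hi.le]
    · simp [hi_mem_tailUnion]
  split_ifs with hii
  · subst hii
    have hc : ((tailUnion 0 ∅).erase (lo i) ∪ (tailUnion 0 ∅).erase (lo i))ᶜ =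
        insert (lo i) ((univ : Finset (Fin k)).map hi) := by
      apply ext_halves <;> intro j <;> simp [lo_mem_tailUnion, hi_mem_tailUnion]
    rw [HO, hc, sum_insert (by simp), sum_map,
      insert_erase (lo_mem_tailUnion.2 (Nat.zero_le _))] at h
    simp only [c, card_empty, pow_zero, one_mul, ← two_mul, pow_mul, neg_one_sq,
      one_pow, map_add, map_mul, map_sum] at h
    rw [pow_two]
    exact eq_neg_of_add_eq_zero_right h
  · have hc : ((tailUnion 0 ∅).erase (lo i) ∪ (tailUnion 0 ∅).erase (lo i'))ᶜ =
        (univ : Finset (Fin k)).map hi := by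
      apply ext_halves <;> intro j <;> simp [lo_mem_tailUnion, hi_mem_tailUnion]
      grind
    rw [HO, hc, sum_map] at h
    simp only [c, card_empty, add_zero, pow_zero, one_mul, map_mul, map_sum] at h
    exact h

lemma det_exchangeMatrix_sq (hφ : ∀ I J : Finset (Fin (2 * k)), I.card = k - 1 →
      J.card = k - 1 → φ (HO (2 * k) k I J) = 0) :
    (exchangeMatrix φ).det ^ 2 = (-1) ^ k * φ (Xv (2 * k) k (tailUnion 0 ∅)) ^ (2 * k) := by
  have h : exchangeMatrix φ * (exchangeMatrix φ).transpose =
      (-φ (Xv (2 * k) k (tailUnion 0 ∅)) ^ 2) • (1 : Matrix (Fin k) (Fin k) A) := by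
    ext i j
    have hs : (-1 : A) ^ j.val * (-1) ^ j.val = 1 := by rw [← mul_pow]; simp
    have := sum_exchange_mul_exchange φ hφ i j
    calc (exchangeMatrix φ * (exchangeMatrix φ).transpose) i j
        = (-1) ^ i.val * (-1) ^ j.val * ∑ t, exchange φ i t * exchange φ j t := by
          simp only [Matrix.mul_apply, Matrix.transpose_apply, exchangeMatrix, Matrix.of_apply,
            mul_sum]
          exact sum_congr rfl fun t _ => by ring
      _ = _ := by
          rw [this, Matrix.smul_apply, Matrix.one_apply]
          split_ifs with hij
          · subst hij
            rw [hs]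
            simp
          · simp
  have h' := congrArg Matrix.det h
  rw [Matrix.det_mul, Matrix.det_transpose, Matrix.det_smul, Matrix.det_one, Fintype.card_fin,
    neg_pow, ← pow_mul] at h'
  rw [pow_two, h', mul_one]

/-- The relation between the squares of two complementary Plücker coordinates. -/
lemma complementary_sq_relation
    (hG : ∀ I J : Finset (Fin (2 * k)), I.card = k - 1 → J.card = k + 1 →
      φ (GP (2 * k) k I J) = 0)
    (hH : ∀ I J : Finset (Fin (2 * k)), I.card = k - 1 → J.card = k - 1 →
      φ (HO (2 * k) k I J) = 0) :
    φ (Xv (2 * k) k (tailUnion 0 ∅)) ^ (2 * k) *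
      (φ (Xv (2 * k) k (tailUnion k univ)) ^ 2 -
        (-1) ^ k * φ (Xv (2 * k) k (tailUnion 0 ∅)) ^ 2) = 0 := by
  have h := coordinate_eq_minor φ hG k le_rfl univ (by simp)
  have hid : ((univ : Finset (Fin k)).orderEmbOfFin (by simp) : Fin k → Fin k) = id :=
    (orderEmbOfFin_unique (by simp) (fun _ => mem_univ _) strictMono_id).symm
  rw [hid, show Fin.castLE (le_refl k) = id from rfl, Matrix.submatrix_id_id] at h
  have hd := det_exchangeMatrix_sq φ hH
  rw [mul_sub, pow_mul']
  rw [pow_mul'] at hd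
  have h2 := congrArg (· ^ 2) h
  simp only [mul_pow, hd] at h2
  rw [h2]
  ring

end Relations

/-- The ideal has no nonzero elements of degree one. -/
lemma aeval_eps_eq_zero_of_mem {n k : ℕ}
    {f : MvPolynomial {K : Finset (Fin n) // K.card = k} ℂ} (hf : f ∈ Ikn n k)
    (a : {K : Finset (Fin n) // K.card = k} → ℂ) :
    MvPolynomial.aeval (fun K => DualNumber.eps * algebraMap ℂ (DualNumber ℂ) (a K)) f = 0 := by
  set ψ := MvPolynomial.aeval (R := ℂ)
    (fun K => DualNumber.eps * algebraMap ℂ (DualNumber ℂ) (a K)) with hψ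
  have hX (K L : Finset (Fin n)) (c : DualNumber ℂ) :
      c * ψ (Xv n k K) * ψ (Xv n k L) = 0 := by
    have h (K : Finset (Fin n)) : ∃ b, ψ (Xv n k K) = DualNumber.eps * b := by
      unfold Xv
      split_ifs with hK
      · exact ⟨_, MvPolynomial.aeval_X _ _⟩
      · exact ⟨0, by simp⟩
    obtain ⟨b, hb⟩ := h K
    obtain ⟨d, hd⟩ := h L
    rw [hb, hd]
    linear_combination c * b * d * (DualNumber.eps_mul_eps (R := ℂ))
  have hle : Ikn n k ≤ RingHom.ker ψ := by
    refine Ideal.span_le.2 ?_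
    rintro _ (⟨I, J, -, -, rfl⟩ | ⟨I, J, -, -, rfl⟩)
    · simp only [SetLike.mem_coe, RingHom.mem_ker, GP, map_sum, map_mul]
      exact sum_eq_zero fun _ _ => hX _ _ _
    · simp only [SetLike.mem_coe, RingHom.mem_ker, HO, map_sum, map_mul]
      exact sum_eq_zero fun _ _ => hX _ _ _
  exact hle hf

/-- A linear form in two distinct variables, one with coefficient one, is not in the ideal. -/
lemma variable_sub_smul_notMem {n k : ℕ} {K L : Finset (Fin n)} (hK : K.card = k) (hL : K ≠ L)
    (c : ℂ) : Xv n k K - MvPolynomial.C c * Xv n k L ∉ Ikn n k := by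
  intro h
  have := aeval_eps_eq_zero_of_mem h (fun M => if M.1 = K then 1 else 0)
  have h' := congrArg TrivSqZeroExt.snd this
  unfold Xv at h'
  rw [dif_pos hK] at h'
  split_ifs at h' <;> simp [hL.symm] at h'

end OrthogonalPlucker

open OrthogonalPlucker in
/-- For `k ≥ 1` and `n = 2k`, the ideal `I_{k,2k}` is **not** prime. -/
theorem statement10 {k : ℕ} (hk : 1 ≤ k) :
    ¬ (Ikn (2 * k) k).IsPrime := by
  intro hP
  have h := complementary_sq_relation (Ideal.Quotient.mk (Ikn (2 * k) k))
    (fun I J hI hJ => Ideal.Quotient.eq_zero_iff_mem.2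
      (Ideal.subset_span (Or.inl ⟨I, J, hI, hJ, rfl⟩)))
    (fun I J hI hJ => Ideal.Quotient.eq_zero_iff_mem.2
      (Ideal.subset_span (Or.inr ⟨I, J, hI, hJ, rfl⟩)))
  have hc0 : (tailUnion 0 (∅ : Finset (Fin k))).card = k := by simp [card_tailUnion]
  have hc1 : (tailUnion k (Finset.univ : Finset (Fin k))).card = k := by simp [card_tailUnion]
  have hne : tailUnion k (Finset.univ : Finset (Fin k)) ≠ tailUnion 0 ∅ := by
    intro he
    have := (lo_mem_tailUnion (r := 0) (T := ∅) (i := (⟨0, hk⟩ : Fin k))).2 le_rfl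
    rw [← he, lo_mem_tailUnion] at this
    simp at this
    omega
  have hI : (MvPolynomial.C (Complex.I ^ k) :
      MvPolynomial {K : Finset (Fin (2 * k)) // K.card = k} ℂ) ^ 2 = (-1) ^ k := by
    rw [← map_pow, ← pow_mul, mul_comm k, pow_mul, Complex.I_sq]
    simp
  have hmem : Xv (2 * k) k (tailUnion 0 ∅) ^ (2 * k) *
      ((Xv (2 * k) k (tailUnion k Finset.univ) -
          MvPolynomial.C (Complex.I ^ k) * Xv (2 * k) k (tailUnion 0 ∅)) *
        (Xv (2 * k) k (tailUnion k Finset.univ) -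
          MvPolynomial.C (-Complex.I ^ k) * Xv (2 * k) k (tailUnion 0 ∅))) ∈ Ikn (2 * k) k := by
    rw [← Ideal.Quotient.eq_zero_iff_mem, ← h]
    simp only [← map_pow, ← map_mul, ← map_sub, ← map_one (Ideal.Quotient.mk (Ikn (2 * k) k)),
      ← map_neg (Ideal.Quotient.mk (Ikn (2 * k) k))]
    congr 2
    rw [← hI, map_neg]
    ring
  rcases hP.mem_or_mem hmem with h0 | h1
  · refine variable_sub_smul_notMem hc0 hne.symm 0 ?_
    simpa using hP.mem_of_pow_mem _ h0
  · rcases hP.mem_or_mem h1 with h2 | h2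
    · exact variable_sub_smul_notMem hc1 hne _ h2
    · exact variable_sub_smul_notMem hc1 hne _ h2
end

section
/- Fix n ≥ 1 and let O (resp. E) be the set of odd (resp. even) indices in {1,…,n}. Let X = {x ∈ ℝⁿ : x_i ≥ 0 for all i, Σ_{i∈O} x_i² = Σ_{j∈E} x_j², and Σ_{i=1}^n x_i² = 1}. For nonempty subsets A ⊆ O and B ⊆ E, let C(A,B) = {x ∈ X : {i : x_i ≠ 0} = A ∪ B}. Then the closure of C(A,B) in ℝⁿ equals {x ∈ X : {i : x_i ≠ 0} ⊆ A ∪ B}, which is the disjoint union of the cells C(C,D) over all nonempty C ⊆ A and nonempty D ⊆ B. -/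
/-- The set `O` of indices of `{1, …, n}` (realized as `Fin n`, with `i : Fin n`
representing `i + 1 ∈ {1, …, n}`) that are odd in one-based labeling. -/
def oddIdx (n : ℕ) : Finset (Fin n) :=
  Finset.univ.filter fun i : Fin n => Odd ((i : ℕ) + 1)

/-- The set `E` of indices of `{1, …, n}` that are even in one-based labeling. -/
def evenIdx (n : ℕ) : Finset (Fin n) :=
  Finset.univ.filter fun i : Fin n => Even ((i : ℕ) + 1)

/-- The unit-sphere model `X` of the positive orthogonal Grassmannian `OGr₊(1,n)`:
nonnegative vectors `x ∈ ℝⁿ` with `∑_{i ∈ O} xᵢ² = ∑_{j ∈ E} xⱼ²` and `∑ᵢ xᵢ² = 1`. -/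
def Xset (n : ℕ) : Set (Fin n → ℝ) :=
  {x | (∀ i, 0 ≤ x i) ∧
    (∑ i ∈ oddIdx n, x i ^ 2) = (∑ j ∈ evenIdx n, x j ^ 2) ∧
    (∑ i, x i ^ 2) = 1}

/-- The cell `C(A,B)` of `X`: points whose support is exactly `A ∪ B`. -/
def cell {n : ℕ} (A B : Finset (Fin n)) : Set (Fin n → ℝ) :=
  {x ∈ Xset n | ∀ i, x i ≠ 0 ↔ i ∈ A ∪ B}

theorem disjoint_oddIdx_evenIdx (n : ℕ) : Disjoint (oddIdx n) (evenIdx n) := by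
  rw [Finset.disjoint_left]
  intro i hi hj
  simp only [oddIdx, evenIdx, Finset.mem_filter, Finset.mem_univ, true_and] at hi hj
  exact (Nat.not_even_iff_odd.mpr hi) hj

theorem oddIdx_union_evenIdx (n : ℕ) : oddIdx n ∪ evenIdx n = Finset.univ := by
  ext i
  simpa [oddIdx, evenIdx] using (Nat.even_or_odd ((i : ℕ) + 1)).symm

theorem sum_oddIdx_add_sum_evenIdx {n : ℕ} (f : Fin n → ℝ) :
    ∑ i ∈ oddIdx n, f i + ∑ i ∈ evenIdx n, f i = ∑ i, f i := by
  rw [← Finset.sum_union (disjoint_oddIdx_evenIdx n), oddIdx_union_evenIdx]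

/-- The defining equations of `Xset` say that both partial sums of squares are `1 / 2`. -/
theorem mem_Xset_iff {n : ℕ} (x : Fin n → ℝ) :
    x ∈ Xset n ↔ (∀ i, 0 ≤ x i) ∧
      ∑ i ∈ oddIdx n, x i ^ 2 = 1 / 2 ∧ ∑ i ∈ evenIdx n, x i ^ 2 = 1 / 2 := by
  have h := sum_oddIdx_add_sum_evenIdx fun i => x i ^ 2
  simp only [Xset, Set.mem_ofPred_eq]
  refine and_congr_right fun _ => ⟨fun ⟨h₁, h₂⟩ => ⟨?_, ?_⟩, fun ⟨h₁, h₂⟩ => ⟨?_, ?_⟩⟩ <;> linarith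

theorem isClosed_Xset (n : ℕ) : IsClosed (Xset n) := by
  refine IsClosed.inter ?_ (IsClosed.inter ?_ ?_)
  · exact isClosed_le continuous_const continuous_id
  · exact isClosed_eq (by fun_prop) (by fun_prop)
  · exact isClosed_eq (by fun_prop) (by fun_prop)

theorem isClosed_Xset_support_subset {n : ℕ} (S : Finset (Fin n)) :
    IsClosed {x ∈ Xset n | ∀ i, x i ≠ 0 → i ∈ S} := by
  refine (isClosed_Xset n).inter ?_
  change IsClosed {x : Fin n → ℝ | ∀ i, x i ≠ 0 → i ∈ S}
  simp only [Set.ofPred_forall]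
  refine isClosed_iInter fun i => ?_
  by_cases hi : i ∈ S
  · simp [hi]
  · simpa [hi] using isClosed_eq (continuous_apply i) continuous_const

theorem cell_nonempty {n : ℕ} {A B : Finset (Fin n)} (hAO : A ⊆ oddIdx n) (hBE : B ⊆ evenIdx n)
    (hA : A.Nonempty) (hB : B.Nonempty) : (cell A B).Nonempty := by
  have hdis := disjoint_oddIdx_evenIdx n
  have hA' : (0 : ℝ) < A.card := by exact_mod_cast hA.card_pos
  have hB' : (0 : ℝ) < B.card := by exact_mod_cast hB.card_pos
  let q : Fin n → ℝ := fun i =>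
    (if i ∈ A then 1 / (2 * (A.card : ℝ)) else 0) + if i ∈ B then 1 / (2 * (B.card : ℝ)) else 0
  have hq : ∀ i, 0 ≤ q i := fun i => by dsimp only [q]; positivity
  have hO : oddIdx n ∩ A = A := Finset.inter_eq_right.mpr hAO
  have hE : evenIdx n ∩ B = B := Finset.inter_eq_right.mpr hBE
  have hOB : oddIdx n ∩ B = ∅ := Finset.disjoint_iff_inter_eq_empty.mp (hdis.mono_right hBE)
  have hEA : evenIdx n ∩ A = ∅ := Finset.disjoint_iff_inter_eq_empty.mp (hdis.symm.mono_right hAO)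
  refine ⟨fun i => √(q i), (mem_Xset_iff _).mpr ⟨fun i => Real.sqrt_nonneg _, ?_, ?_⟩, fun i => ?_⟩
  · simp only [Real.sq_sqrt (hq _), q, Finset.sum_add_distrib, Finset.sum_ite_mem, hO, hOB,
      Finset.sum_const, nsmul_eq_mul]
    field_simp
    simp
  · simp only [Real.sq_sqrt (hq _), q, Finset.sum_add_distrib, Finset.sum_ite_mem, hE, hEA,
      Finset.sum_const, nsmul_eq_mul]
    field_simp
    simp
  · rw [Real.sqrt_ne_zero (hq i), Finset.mem_union]
    by_cases h₁ : i ∈ A <;> by_cases h₂ : i ∈ B <;> simp [q, h₁, h₂, hA.ne_empty, hB.ne_empty]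
    positivity

/-- Interpolating linearly between the squares of the coordinates moves a point of `X` supported
in `A ∪ B` into the cell `C(A,B)`. -/
theorem sqrt_interpolation_mem_cell {n : ℕ} {A B : Finset (Fin n)} {x p : Fin n → ℝ}
    (hx : x ∈ Xset n) (hxs : ∀ i, x i ≠ 0 → i ∈ A ∪ B) (hp : p ∈ cell A B) {t : ℝ}
    (ht : t ∈ Set.Ioc (0 : ℝ) 1) :
    (fun i => √((1 - t) * x i ^ 2 + t * p i ^ 2)) ∈ cell A B := by
  obtain ⟨ht₀, ht₁⟩ := ht
  obtain ⟨hpX, hps⟩ := hp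
  obtain ⟨-, hxO, hxE⟩ := (mem_Xset_iff x).mp hx
  obtain ⟨-, hpO, hpE⟩ := (mem_Xset_iff p).mp hpX
  have ht₂ : 0 ≤ 1 - t := sub_nonneg.mpr ht₁
  have hq : ∀ i, 0 ≤ (1 - t) * x i ^ 2 + t * p i ^ 2 := fun i => by positivity
  refine ⟨(mem_Xset_iff _).mpr ⟨fun i => Real.sqrt_nonneg _, ?_, ?_⟩, fun i => ?_⟩
  · simp only [Real.sq_sqrt (hq _), Finset.sum_add_distrib, ← Finset.mul_sum, hxO, hpO]
    ring
  · simp only [Real.sq_sqrt (hq _), Finset.sum_add_distrib, ← Finset.mul_sum, hxE, hpE]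
    ring
  · rw [Real.sqrt_ne_zero (hq i)]
    by_cases hi : i ∈ A ∪ B
    · have := (hps i).mpr hi
      simp only [hi, iff_true]
      positivity
    · have h₁ : x i = 0 := not_not.mp (mt (hxs i) hi)
      have h₂ : p i = 0 := not_not.mp (mt (hps i).mp hi)
      simp [hi, h₁, h₂]

theorem closure_cell {n : ℕ} {A B : Finset (Fin n)} (hAO : A ⊆ oddIdx n) (hBE : B ⊆ evenIdx n)
    (hA : A.Nonempty) (hB : B.Nonempty) :
    closure (cell A B) = {x ∈ Xset n | ∀ i, x i ≠ 0 → i ∈ A ∪ B} := by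
  refine Set.Subset.antisymm (closure_minimal (fun x hx => ⟨hx.1, fun i => (hx.2 i).mp⟩)
    (isClosed_Xset_support_subset _)) ?_
  rintro x ⟨hx, hxs⟩
  obtain ⟨p, hp⟩ := cell_nonempty hAO hBE hA hB
  have hcont : Continuous fun (t : ℝ) (i : Fin n) => √((1 - t) * x i ^ 2 + t * p i ^ 2) := by
    fun_prop
  have h₀ : (0 : ℝ) ∈ closure (Set.Ioc 0 1) := by
    rw [closure_Ioc zero_ne_one]
    exact ⟨le_rfl, zero_le_one⟩
  have h := map_mem_closure hcont h₀ fun t ht => sqrt_interpolation_mem_cell hx hxs hp ht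
  simpa [Real.sqrt_sq (hx.1 _)] using h

theorem Xset_support_subset_eq_iUnion_cell {n : ℕ} {A B : Finset (Fin n)}
    (hAO : A ⊆ oddIdx n) (hBE : B ⊆ evenIdx n) :
    {x ∈ Xset n | ∀ i, x i ≠ 0 → i ∈ A ∪ B} =
      ⋃ (C : Finset (Fin n)) (_ : C.Nonempty ∧ C ⊆ A)
        (D : Finset (Fin n)) (_ : D.Nonempty ∧ D ⊆ B), cell C D := by
  have hdis := Finset.disjoint_left.mp (disjoint_oddIdx_evenIdx n)
  ext x
  simp only [Set.mem_iUnion, exists_prop]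
  constructor
  · rintro ⟨hx, hxs⟩
    obtain ⟨-, hxO, hxE⟩ := (mem_Xset_iff x).mp hx
    obtain ⟨i, hi, hi₀⟩ := Finset.exists_ne_zero_of_sum_ne_zero (hxO.trans_ne (by norm_num))
    obtain ⟨j, hj, hj₀⟩ := Finset.exists_ne_zero_of_sum_ne_zero (hxE.trans_ne (by norm_num))
    replace hi₀ : x i ≠ 0 := by simpa using hi₀
    replace hj₀ : x j ≠ 0 := by simpa using hj₀
    have hiA : i ∈ A := (Finset.mem_union.mp (hxs i hi₀)).resolve_right fun h => hdis hi (hBE h)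
    have hjB : j ∈ B := (Finset.mem_union.mp (hxs j hj₀)).resolve_left fun h => hdis (hAO h) hj
    refine ⟨A.filter (x · ≠ 0), ⟨⟨i, Finset.mem_filter.mpr ⟨hiA, hi₀⟩⟩, Finset.filter_subset _ _⟩,
      B.filter (x · ≠ 0), ⟨⟨j, Finset.mem_filter.mpr ⟨hjB, hj₀⟩⟩, Finset.filter_subset _ _⟩,
      hx, fun k => ?_⟩
    rw [← Finset.filter_union, Finset.mem_filter]
    exact ⟨fun hk => ⟨hxs k hk, hk⟩, And.right⟩
  · rintro ⟨C, ⟨-, hC⟩, D, ⟨-, hD⟩, hx, hxs⟩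
    exact ⟨hx, fun i hi => Finset.union_subset_union hC hD ((hxs i).mp hi)⟩

theorem disjoint_cell {n : ℕ} {C₁ D₁ C₂ D₂ : Finset (Fin n)}
    (hC₁ : C₁ ⊆ oddIdx n) (hD₁ : D₁ ⊆ evenIdx n) (hC₂ : C₂ ⊆ oddIdx n) (hD₂ : D₂ ⊆ evenIdx n)
    (hne : (C₁, D₁) ≠ (C₂, D₂)) : Disjoint (cell C₁ D₁) (cell C₂ D₂) := by
  have hdis := Finset.disjoint_left.mp (disjoint_oddIdx_evenIdx n)
  rw [Set.disjoint_left]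
  rintro x ⟨-, h₁⟩ ⟨-, h₂⟩
  have h : ∀ i, i ∈ C₁ ∪ D₁ ↔ i ∈ C₂ ∪ D₂ := fun i => (h₁ i).symm.trans (h₂ i)
  simp only [Finset.mem_union] at h
  refine hne (Prod.ext (Finset.ext fun i => ?_) (Finset.ext fun i => ?_))
  · exact ⟨fun hi => ((h i).mp (.inl hi)).resolve_right fun h' => hdis (hC₁ hi) (hD₂ h'),
      fun hi => ((h i).mpr (.inl hi)).resolve_right fun h' => hdis (hC₂ hi) (hD₁ h')⟩
  · exact ⟨fun hi => ((h i).mp (.inr hi)).resolve_left fun h' => hdis (hC₂ h') (hD₁ hi),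
      fun hi => ((h i).mpr (.inr hi)).resolve_left fun h' => hdis (hC₁ h') (hD₂ hi)⟩

/-- For nonempty `A ⊆ O` and `B ⊆ E`, the closure of the cell
`C(A,B)` in `ℝⁿ` equals `{x ∈ X : supp(x) ⊆ A ∪ B}`, which is the disjoint union of
the cells `C(C,D)` over nonempty `C ⊆ A` and nonempty `D ⊆ B`. -/
theorem statement11 {n : ℕ} (hn : 1 ≤ n) (A B : Finset (Fin n))
    (hAO : A ⊆ oddIdx n) (hBE : B ⊆ evenIdx n)
    (hA : A.Nonempty) (hB : B.Nonempty) :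
    closure (cell A B) = {x ∈ Xset n | ∀ i, x i ≠ 0 → i ∈ A ∪ B} ∧
    ({x ∈ Xset n | ∀ i, x i ≠ 0 → i ∈ A ∪ B} =
      ⋃ (C : Finset (Fin n)) (_ : C.Nonempty ∧ C ⊆ A)
        (D : Finset (Fin n)) (_ : D.Nonempty ∧ D ⊆ B), cell C D) ∧
    (∀ C₁ D₁ C₂ D₂ : Finset (Fin n), C₁ ⊆ A → D₁ ⊆ B → C₂ ⊆ A → D₂ ⊆ B →
      (C₁, D₁) ≠ (C₂, D₂) → Disjoint (cell C₁ D₁) (cell C₂ D₂)) := by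
  exact ⟨closure_cell hAO hBE hA hB, Xset_support_subset_eq_iUnion_cell hAO hBE,
    fun _ _ _ _ hC₁ hD₁ hC₂ hD₂ => disjoint_cell (hC₁.trans hAO) (hD₁.trans hBE)
      (hC₂.trans hAO) (hD₂.trans hBE)⟩
end

section
/- Fix n ≥ 1 and let O (resp. E) be the set of odd (resp. even) indices in {1,…,n}. Let X = {x ∈ ℝⁿ : x_i ≥ 0 for all i, Σ_{i∈O} x_i² = Σ_{j∈E} x_j², and Σ_{i=1}^n x_i² = 1}, and for nonempty A ⊆ O, B ⊆ E let C(A,B) = {x ∈ X : {i : x_i ≠ 0} = A ∪ B}. Then the map sending a pair (u, v), with u = (u_i)_{i∈A} ∈ ℝ_{>0}^A satisfying Σ_{i∈A} u_i² = 1 and v = (v_j)_{j∈B} ∈ ℝ_{>0}^B satisfying Σ_{j∈B} v_j² = 1, to the point x ∈ ℝⁿ with x_i = u_i/√2 for i ∈ A, x_j = v_j/√2 for j ∈ B, and x_i = 0 otherwise, is a homeomorphism from the product of the open positive parts of the unit spheres in ℝ^A and ℝ^B onto the cell C(A,B). In particular every cell C(A,B) is nonempty and homeomorphic to ℝ^{|A|+|B|−2}.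 -/
/-- The open positive part of the unit sphere in `ℝ^A`. -/
def posSphere {n : ℕ} (A : Finset (Fin n)) : Set (A → ℝ) :=
  {u | (∀ i, 0 < u i) ∧ (∑ i, u i ^ 2) = 1}

/-- The gluing map sending `(u, v)` with `u ∈ ℝ^A`, `v ∈ ℝ^B` to the point of `ℝⁿ`
whose coordinates are `uᵢ/√2` on `A`, `vⱼ/√2` on `B`, and `0` elsewhere. -/
noncomputable def glue {n : ℕ} (A B : Finset (Fin n)) (u : A → ℝ) (v : B → ℝ) :
    Fin n → ℝ := fun i =>
  if h : i ∈ A then u ⟨i, h⟩ / Real.sqrt 2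
  else if h : i ∈ B then v ⟨i, h⟩ / Real.sqrt 2
  else 0

/-- Membership in a cell, with the two quadratic equations restricted to the support. -/
theorem mem_cell_iff {n : ℕ} {A B : Finset (Fin n)} (hAO : A ⊆ oddIdx n) (hBE : B ⊆ evenIdx n)
    {x : Fin n → ℝ} :
    x ∈ cell A B ↔ (∀ i ∈ A, 0 < x i) ∧ (∀ i ∈ B, 0 < x i) ∧
      (∀ i, i ∉ A → i ∉ B → x i = 0) ∧
      ∑ i ∈ A, x i ^ 2 = 1 / 2 ∧ ∑ i ∈ B, x i ^ 2 = 1 / 2 := by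
  have hdisj := Finset.disjoint_left.mp (disjoint_oddIdx_evenIdx n)
  have hsum : (∀ i, i ∉ A → i ∉ B → x i = 0) →
      ∑ i ∈ A, x i ^ 2 = ∑ i ∈ oddIdx n, x i ^ 2 ∧
      ∑ i ∈ B, x i ^ 2 = ∑ i ∈ evenIdx n, x i ^ 2 := by
    intro h0
    refine ⟨Finset.sum_subset hAO fun i hi hiA => ?_, Finset.sum_subset hBE fun i hi hiB => ?_⟩
    · simp [h0 i hiA fun hiB => hdisj hi (hBE hiB)]
    · simp [h0 i (fun hiA => hdisj (hAO hiA) hi) hiB]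
  have hsplit := sum_oddIdx_add_sum_evenIdx fun i => x i ^ 2
  constructor
  · rintro ⟨⟨hnn, heq, hone⟩, hsupp⟩
    have h0 : ∀ i, i ∉ A → i ∉ B → x i = 0 := fun i hA hB => by
      by_contra h
      have := (hsupp i).mp h
      simp_all
    obtain ⟨h1, h2⟩ := hsum h0
    refine ⟨fun i hi => (hnn i).lt_of_ne' ((hsupp i).mpr (Finset.mem_union_left _ hi)),
      fun i hi => (hnn i).lt_of_ne' ((hsupp i).mpr (Finset.mem_union_right _ hi)), h0, ?_, ?_⟩ <;>
    linarith
  · rintro ⟨hA, hB, h0, hsA, hsB⟩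
    obtain ⟨h1, h2⟩ := hsum h0
    refine ⟨⟨fun i => ?_, by linarith, by linarith⟩, fun i => ⟨fun h => ?_, fun h => ?_⟩⟩
    · by_cases hiA : i ∈ A
      · exact (hA i hiA).le
      by_cases hiB : i ∈ B
      · exact (hB i hiB).le
      exact (h0 i hiA hiB).ge
    · by_contra hi
      rw [Finset.mem_union, not_or] at hi
      exact h (h0 i hi.1 hi.2)
    · rcases Finset.mem_union.mp h with h | h
      · exact (hA i h).ne'
      · exact (hB i h).ne'

theorem glue_of_mem_left {n : ℕ} {A B : Finset (Fin n)} (u : A → ℝ) (v : B → ℝ) (i : A) :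
    glue A B u v i = u i / √2 := by
  simp [glue]

theorem glue_of_mem_right {n : ℕ} {A B : Finset (Fin n)} (hAB : Disjoint A B)
    (u : A → ℝ) (v : B → ℝ) (i : B) :
    glue A B u v i = v i / √2 := by
  simp [glue, Finset.disjoint_right.mp hAB i.2]

theorem continuous_glue {n : ℕ} (A B : Finset (Fin n)) :
    Continuous fun p : (A → ℝ) × (B → ℝ) => glue A B p.1 p.2 := by
  refine continuous_pi fun i => ?_
  unfold glue
  split_ifs <;> fun_prop

theorem glue_mem_cell {n : ℕ} {A B : Finset (Fin n)} (hAO : A ⊆ oddIdx n) (hBE : B ⊆ evenIdx n)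
    {u : A → ℝ} {v : B → ℝ} (hu : u ∈ posSphere A) (hv : v ∈ posSphere B) :
    glue A B u v ∈ cell A B := by
  have hAB : Disjoint A B := (disjoint_oddIdx_evenIdx n).mono hAO hBE
  refine (mem_cell_iff hAO hBE).mpr ⟨fun i hi => ?_, fun i hi => ?_, fun i hA hB => ?_, ?_, ?_⟩
  · rw [glue_of_mem_left u v ⟨i, hi⟩]
    exact div_pos (hu.1 _) (by positivity)
  · rw [glue_of_mem_right hAB u v ⟨i, hi⟩]
    exact div_pos (hv.1 _) (by positivity)
  · simp [glue, hA, hB]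
  · rw [← Finset.sum_coe_sort]
    simp only [glue_of_mem_left, div_pow, ← Finset.sum_div, hu.2]
    norm_num
  · rw [← Finset.sum_coe_sort]
    simp only [glue_of_mem_right hAB, div_pow, ← Finset.sum_div, hv.2]
    norm_num

/-- Rescaling a vector whose squares sum to `1 / 2` over `A` gives a point of the sphere. -/
theorem sqrt_two_mul_mem_posSphere {n : ℕ} {A : Finset (Fin n)} {x : Fin n → ℝ}
    (hpos : ∀ i ∈ A, 0 < x i) (hsum : ∑ i ∈ A, x i ^ 2 = 1 / 2) :
    (fun i : A => √2 * x i) ∈ posSphere A := by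
  refine ⟨fun i => mul_pos (by positivity) (hpos i i.2), ?_⟩
  simp only [mul_pow, ← Finset.mul_sum]
  rw [Finset.sum_coe_sort A fun i => x i ^ 2, hsum]
  norm_num

/-- Gluing as a homeomorphism from a product of open positive spheres onto a cell. -/
noncomputable def glueHomeomorph {n : ℕ} {A B : Finset (Fin n)}
    (hAO : A ⊆ oddIdx n) (hBE : B ⊆ evenIdx n) :
    ↥(posSphere A ×ˢ posSphere B) ≃ₜ ↥(cell A B) where
  toFun p := ⟨glue A B p.1.1 p.1.2, glue_mem_cell hAO hBE p.2.1 p.2.2⟩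
  invFun x := ⟨(fun i => √2 * x.1 i, fun i => √2 * x.1 i), by
    obtain ⟨hA, hB, -, hsA, hsB⟩ := (mem_cell_iff hAO hBE).mp x.2
    exact ⟨sqrt_two_mul_mem_posSphere hA hsA, sqrt_two_mul_mem_posSphere hB hsB⟩⟩
  left_inv p := by
    have hAB : Disjoint A B := (disjoint_oddIdx_evenIdx n).mono hAO hBE
    refine Subtype.ext (Prod.ext (funext fun i => ?_) (funext fun i => ?_))
    · simp only [glue_of_mem_left]
      field_simp
    · simp only [glue_of_mem_right hAB]
      field_simp
  right_inv x := by
    obtain ⟨-, -, h0, -, -⟩ := (mem_cell_iff hAO hBE).mp x.2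
    refine Subtype.ext (funext fun i => ?_)
    by_cases hA : i ∈ A
    · simp [glue, hA]
    by_cases hB : i ∈ B
    · simp [glue, hA, hB]
    simp [glue, hA, hB, h0]
  continuous_toFun := ((continuous_glue A B).comp continuous_subtype_val).subtype_mk _
  continuous_invFun := by
    refine Continuous.subtype_mk (Continuous.prodMk ?_ ?_) _ <;>
    exact continuous_pi fun i =>
      continuous_const.mul ((continuous_apply _).comp continuous_subtype_val)

/-- The logarithmic coordinates `log (uᵢ / u_a)`, for `i ≠ a`, identify the open positive part
of the unit sphere in `ℝ^A` with a Euclidean space. -/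
noncomputable def posSphereHomeomorph {n : ℕ} {A : Finset (Fin n)} (a : A) :
    ↥(posSphere A) ≃ₜ ({i : A // i ≠ a} → ℝ) where
  toFun u i := Real.log (u.1 i / u.1 a)
  invFun w :=
    let f : A → ℝ := fun i => if h : i = a then 1 else Real.exp (w ⟨i, h⟩)
    ⟨fun i => f i / √(∑ j, f j ^ 2), by
      have hf : ∀ i, 0 < f i := fun i => by
        simp only [f]
        split_ifs <;> positivity
      have hs : 0 < ∑ j, f j ^ 2 :=
        Finset.sum_pos (fun i _ => pow_pos (hf i) 2) ⟨a, Finset.mem_univ a⟩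
      refine ⟨fun i => div_pos (hf i) (Real.sqrt_pos.mpr hs), ?_⟩
      simp only [div_pow, ← Finset.sum_div, Real.sq_sqrt hs.le]
      exact div_self hs.ne'⟩
  left_inv u := by
    have ha := u.2.1 a
    have key : ∀ i : A, (if h : i = a then (1 : ℝ) else Real.exp (Real.log (u.1 i / u.1 a)))
        = u.1 i / u.1 a := fun i => by
      split_ifs with h
      · rw [h, div_self ha.ne']
      · exact Real.exp_log (div_pos (u.2.1 i) ha)
    refine Subtype.ext (funext fun i => ?_)
    simp only [key, div_pow, ← Finset.sum_div, u.2.2]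
    rw [Real.sqrt_div zero_le_one, Real.sqrt_one, Real.sqrt_sq ha.le]
    field_simp
  right_inv w := by
    funext i
    have hs : 0 < ∑ j, (if h : j = a then (1 : ℝ) else Real.exp (w ⟨j, h⟩)) ^ 2 := by
      refine Finset.sum_pos (fun j _ => ?_) ⟨a, Finset.mem_univ a⟩
      split_ifs <;> positivity
    simp only [div_div_div_cancel_right₀ (Real.sqrt_pos.mpr hs).ne']
    simp [i.2]
  continuous_toFun := by
    refine continuous_pi fun i => Continuous.log (Continuous.div ?_ ?_ fun u => (u.2.1 a).ne')
      fun u => (div_pos (u.2.1 i) (u.2.1 a)).ne'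
    all_goals exact (continuous_apply _).comp continuous_subtype_val
  continuous_invFun := by
    have hf : ∀ i : A, Continuous fun w : {i : A // i ≠ a} → ℝ =>
        if h : i = a then (1 : ℝ) else Real.exp (w ⟨i, h⟩) := fun i => by
      split_ifs <;> fun_prop
    refine Continuous.subtype_mk (continuous_pi fun i => (hf i).div ?_ fun w => ?_) _
    · exact (continuous_finsetSum _ fun j _ => (hf j).pow 2).sqrt
    · refine (Real.sqrt_pos.mpr (Finset.sum_pos (fun j _ => ?_) ⟨a, Finset.mem_univ a⟩)).ne'
      dsimp only
      split_ifs <;> positivity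
/-- For nonempty `A ⊆ O` and `B ⊆ E`, the gluing map is a
homeomorphism from the product of the open positive parts of the unit spheres in `ℝ^A`
and `ℝ^B` onto the cell `C(A,B)`; in particular every cell `C(A,B)` is nonempty and
homeomorphic to `ℝ^{|A| + |B| - 2}`. -/
theorem statement12 {n : ℕ} (hn : 1 ≤ n) (A B : Finset (Fin n))
    (hAO : A ⊆ oddIdx n) (hBE : B ⊆ evenIdx n)
    (hA : A.Nonempty) (hB : B.Nonempty) :
    (∃ e : ↥(posSphere A ×ˢ posSphere B) ≃ₜ ↥(cell A B),
      ∀ p : ↥(posSphere A ×ˢ posSphere B),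
        (e p : Fin n → ℝ) = glue A B (p : (A → ℝ) × (B → ℝ)).1 (p : (A → ℝ) × (B → ℝ)).2) ∧
    (cell A B).Nonempty ∧
    Nonempty (↥(cell A B) ≃ₜ (Fin (A.card + B.card - 2) → ℝ)) := by
  classical
  obtain ⟨a, ha⟩ := hA
  obtain ⟨b, hb⟩ := hB
  have hcard : Fintype.card ({i : A // i ≠ ⟨a, ha⟩} ⊕ {i : B // i ≠ ⟨b, hb⟩}) =
      A.card + B.card - 2 := by
    have hA1 : 0 < A.card := Finset.card_pos.mpr ⟨a, ha⟩
    have hB1 : 0 < B.card := Finset.card_pos.mpr ⟨b, hb⟩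
    simp only [Fintype.card_sum, ne_eq, Fintype.card_subtype_compl, Fintype.card_coe,
      Fintype.card_subtype_eq]
    omega
  let e : ↥(cell A B) ≃ₜ (Fin (A.card + B.card - 2) → ℝ) :=
    (glueHomeomorph hAO hBE).symm.trans <|
      (Homeomorph.Set.prod (posSphere A) (posSphere B)).trans <|
      ((posSphereHomeomorph ⟨a, ha⟩).prodCongr (posSphereHomeomorph ⟨b, hb⟩)).trans <|
      Homeomorph.sumArrowHomeomorphProdArrow.symm.trans <|
      Homeomorph.piCongrLeft (Y := fun _ => ℝ) (Fintype.equivFinOfCardEq hcard)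
  exact ⟨⟨glueHomeomorph hAO hBE, fun _ => rfl⟩, ⟨_, (e.symm 0).2⟩, ⟨e⟩⟩
end

section
/- Let 1 ≤ k ≤ n. Let A be a real k×n matrix of rank k and let B be a real (n−k)×n matrix of rank n−k whose row space equals the ω₀-orthogonal complement {y ∈ ℝⁿ : ω₀(a, y) = 0 for every row a of A} of the row space of A. Then there exists a nonzero real number c such that for every (n−k)-element subset J of {1,…,n}, p_J(B) = c · p_{Jᶜ}(A), where Jᶜ = {1,…,n}∖J. In other words, in Plücker coordinates the Hodge star map V ↦ V^⊥ on Gr(k,n) is given (projectively) by q_J = p_{Jᶜ}. -/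
open Matrix

/-- The Plücker coordinate `p_I(A)` of a `k × n` matrix `A`: the determinant of the
`k × k` submatrix of `A` whose columns are indexed by `I`, taken in increasing order.
(Defined to be `0` when `I` does not have exactly `k` elements.) -/
noncomputable def plucker {R : Type} [CommRing R] {k n : ℕ}
    (A : Matrix (Fin k) (Fin n) R) (I : Finset (Fin n)) : R :=
  if h : I.card = k then
    (Matrix.of fun (i : Fin k) (j : Fin k) => A i (I.orderEmbOfFin h j)).det
  else 0


namespace Matrix

theorem mul_diagonal_mul_diagonal_mul {R l m n : Type*} [CommRing R] [Fintype n] [DecidableEq n]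
    {d : n → R} (hd : ∀ i, d i * d i = 1) (M : Matrix l n R) (N : Matrix n m R) :
    M * diagonal d * (diagonal d * N) = M * N := by
  have hdd : diagonal d * diagonal d = 1 := by
    rw [diagonal_mul_diagonal, ← diagonal_one]
    exact congrArg diagonal (funext hd)
  rw [Matrix.mul_assoc, ← Matrix.mul_assoc (diagonal d), hdd, Matrix.one_mul]

/-- Complementary minors of two matrices whose rows are orthogonal for the diagonal form `d`,
where `d i * d i = 1`. -/
theorem det_submatrix_mul_det_of_orthogonal {R m k n : Type*} [CommRing R] [Fintype m]
    [DecidableEq m] [Fintype k] [DecidableEq k] [Fintype n] [DecidableEq n] {d : n → R}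
    (hd : ∀ i, d i * d i = 1)
    (A : Matrix k n R) (B : Matrix m n R) (horth : A * (diagonal d * Bᵀ) = 0) (e : m ⊕ k ≃ n) :
    ((fromRows (B * diagonal d) A).submatrix id e).det *
        ((∏ i, d (e (Sum.inl i))) * (B.submatrix id (e ∘ Sum.inl)).det) =
      (B * Bᵀ).det * (A.submatrix id (e ∘ Sum.inr)).det := by
  have hBB := mul_diagonal_mul_diagonal_mul hd B Bᵀ
  have hcols : (fromCols (diagonal d * Bᵀ) ((1 : Matrix n n R).submatrix id (e ∘ Sum.inr))).submatrix
      e id = fromBlocks ((diagonal d * Bᵀ).submatrix (e ∘ Sum.inl) id) 0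
        ((diagonal d * Bᵀ).submatrix (e ∘ Sum.inr) id) 1 := by
    ext (i | i) (j | j) <;> simp [one_apply]
  have hprod := congrArg det (submatrix_mul_equiv (fromRows (B * diagonal d) A)
    (fromCols (diagonal d * Bᵀ) ((1 : Matrix n n R).submatrix id (e ∘ Sum.inr))) id e id)
  have hdiag : ((diagonal d * Bᵀ).submatrix (e ∘ Sum.inl) id).det =
      (∏ i, d (e (Sum.inl i))) * (B.submatrix id (e ∘ Sum.inl)).det := by
    rw [← det_transpose (B.submatrix id (e ∘ Sum.inl)), ← det_mul_column]
    congr 1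
    ext i j
    simp [diagonal_mul]
  have hA : A * (1 : Matrix n n R).submatrix id (e ∘ Sum.inr) = A.submatrix id (e ∘ Sum.inr) := by
    ext i j
    simp [mul_apply, one_apply]
  rwa [det_mul, hcols, det_fromBlocks_zero₁₂, det_one, mul_one, hdiag, submatrix_id_id,
    fromRows_mul_fromCols, horth, det_fromBlocks_zero₂₁, hBB, hA] at hprod

theorem det_mul_transpose_ne_zero_of_rank_eq_card {K m n : Type*} [Field K] [LinearOrder K]
    [IsStrictOrderedRing K] [Fintype m] [DecidableEq m] [Fintype n] (A : Matrix m n K)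
    (hA : A.rank = Fintype.card m) : (A * Aᵀ).det ≠ 0 := by
  rw [← isUnit_iff_ne_zero, ← isUnit_iff_isUnit_det, ← linearIndependent_rows_iff_isUnit,
    linearIndependent_iff_card_eq_finrank_span, Set.finrank, ← rank_eq_finrank_span_row,
    rank_self_mul_transpose, hA]

theorem det_submatrix_fromRows_ne_zero {K m k n : Type*} [Field K] [LinearOrder K]
    [IsStrictOrderedRing K] [Fintype m] [DecidableEq m] [Fintype k] [DecidableEq k] [Fintype n]
    [DecidableEq n] {d : n → K} (hd : ∀ i, d i * d i = 1) (A : Matrix k n K) (B : Matrix m n K)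
    (hA : A.rank = Fintype.card k) (hB : B.rank = Fintype.card m)
    (horth : A * (diagonal d * Bᵀ) = 0) (e : m ⊕ k ≃ n) :
    ((fromRows (B * diagonal d) A).submatrix id e).det ≠ 0 := by
  have hBB := mul_diagonal_mul_diagonal_mul hd B Bᵀ
  have hprod := congrArg det (submatrix_mul_equiv (fromRows (B * diagonal d) A)
    (fromRows (B * diagonal d) A)ᵀ id e id)
  rw [det_mul, submatrix_id_id, transpose_fromRows, fromRows_mul_fromCols, transpose_mul,
    diagonal_transpose, horth, det_fromBlocks_zero₂₁, hBB] at hprod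
  intro h
  rw [h, zero_mul] at hprod
  exact mul_ne_zero (det_mul_transpose_ne_zero_of_rank_eq_card B hB)
    (det_mul_transpose_ne_zero_of_rank_eq_card A hA) hprod.symm

end Matrix

theorem Fin.prod_ite_lt_neg_one {n : ℕ} (b : Fin n) :
    ∏ x : Fin n, (if x < b then (-1 : ℤˣ) else 1) = (-1) ^ (b : ℕ) := by
  rw [Finset.prod_ite, Finset.prod_const, Finset.prod_const_one, mul_one, Finset.filter_gt_eq_Iio,
    Fin.card_Iio]

/-- The sign of the shuffle listing first one part of `Fin n` and then its complement, each in
increasing order. -/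
theorem sign_shuffle_mul_prod {m k n : ℕ} (h : m + k = n) (e : Fin m ⊕ Fin k ≃ Fin n)
    (hl : StrictMono (e ∘ Sum.inl)) (hr : StrictMono (e ∘ Sum.inr)) :
    Equiv.Perm.sign (e.trans (finSumFinEquiv.trans (finCongr h)).symm) *
      ∏ i, (-1) ^ (e (Sum.inl i) : ℕ) = ∏ i : Fin m, (-1 : ℤˣ) ^ (i : ℕ) := by
  subst h
  have hsign : Equiv.Perm.sign (e.trans (finSumFinEquiv.trans (finCongr rfl)).symm) =
      Equiv.Perm.sign (finSumFinEquiv.symm.trans e) := by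
    rw [← Equiv.Perm.sign_permCongr finSumFinEquiv]
    congr 1
    ext x
    simp [Equiv.permCongr_apply]
  have hinv : ∀ i, ∏ a, (if e (Sum.inl i) < e (Sum.inr a) then (1 : ℤˣ) else -1) =
      (-1) ^ (i : ℕ) * (-1) ^ (e (Sum.inl i) : ℕ) := by
    intro i
    have hswap : ∀ a, (if e (Sum.inl i) < e (Sum.inr a) then (1 : ℤˣ) else -1) =
        if e (Sum.inr a) < e (Sum.inl i) then -1 else 1 := by
      intro a
      have hne : e (Sum.inr a) ≠ e (Sum.inl i) := by simp
      rcases hne.lt_or_gt with h | h <;> simp [h, h.not_gt]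
    have hlt : ∀ j, e (Sum.inl j) < e (Sum.inl i) ↔ j < i := fun _ => hl.lt_iff_lt
    rw [← Fin.prod_ite_lt_neg_one (e (Sum.inl i)), ← Equiv.prod_comp e, Fintype.prod_sum_type]
    simp_rw [hswap, hlt, Fin.prod_ite_lt_neg_one]
    rw [← mul_assoc, ← mul_pow, neg_one_mul, neg_neg, one_pow, one_mul]
  have hmono : ∀ p : ℕ, ∀ f : Fin p → Fin (m + k), StrictMono f →
      ∀ i, ∏ j, (if i < j then (if f i < f j then (1 : ℤˣ) else -1) else 1) = 1 :=
    fun p f hf i => Finset.prod_eq_one fun j _ => by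
      by_cases hij : i < j <;> simp [hij, hf.lt_iff_lt]
  have hl' := hmono m (e ∘ Sum.inl) hl
  have hr' := hmono k (e ∘ Sum.inr) hr
  simp only [Function.comp_apply] at hl' hr'
  have hright : ∀ a : Fin k, ∀ i : Fin m, ¬ Fin.natAdd m a < Fin.castAdd k i := by
    intro a i
    simp only [Fin.lt_def, Fin.val_natAdd, Fin.val_castAdd]
    omega
  have hleft : ∀ a : Fin k, ∀ i : Fin m, Fin.castAdd k i < Fin.natAdd m a := by
    intro a i
    simp only [Fin.lt_def, Fin.val_natAdd, Fin.val_castAdd]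
    omega
  have hcast : ∀ i j : Fin m, Fin.castAdd k i < Fin.castAdd k j ↔ i < j := fun _ _ => Iff.rfl
  have hnat : ∀ i j : Fin k, Fin.natAdd m i < Fin.natAdd m j ↔ i < j := by
    simp
  rw [hsign, Equiv.Perm.sign_eq_prod_prod_Ioi]
  simp_rw [← Finset.filter_lt_eq_Ioi, Finset.prod_filter, Fin.prod_univ_add, Equiv.trans_apply,
    finSumFinEquiv_symm_apply_castAdd, finSumFinEquiv_symm_apply_natAdd, hright, hleft, hcast, hnat,
    hl', hr', if_true, if_false, Finset.prod_const_one, mul_one, one_mul, hinv]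
  rw [Finset.prod_const_one, mul_one, ← Finset.prod_mul_distrib]
  refine Finset.prod_congr rfl fun i _ => ?_
  rw [mul_assoc, ← mul_pow, neg_one_mul, neg_neg, one_pow, mul_one]

/-- Let `A` be a real `k × n` matrix of rank `k` and let `B` be a real
`(n-k) × n` matrix of rank `n - k` whose row space is the `ω₀`-orthogonal complement of
the row space of `A`, where `ω₀(x, y) = ∑ᵢ (-1)^{i-1} xᵢ yᵢ`.  Then there is a nonzero
real `c` with `p_J(B) = c · p_{Jᶜ}(A)` for every `(n-k)`-element subset `J`: in Plücker
coordinates the Hodge star map `V ↦ V^⊥` is given projectively by `q_J = p_{Jᶜ}`. -/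
theorem statement13 {k n : ℕ} (hk : 1 ≤ k) (hkn : k ≤ n)
    (A : Matrix (Fin k) (Fin n) ℝ) (hA : A.rank = k)
    (B : Matrix (Fin (n - k)) (Fin n) ℝ) (hB : B.rank = n - k)
    (hperp : (Submodule.span ℝ (Set.range fun i => B i) : Set (Fin n → ℝ)) =
      {y | ∀ i : Fin k, ∑ j : Fin n, ((-1 : ℝ) ^ (j : ℕ)) * A i j * y j = 0}) :
    ∃ c : ℝ, c ≠ 0 ∧ ∀ J : Finset (Fin n), J.card = n - k →
      plucker B J = c * plucker A Jᶜ := by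
  have hmk : n - k + k = n := Nat.sub_add_cancel hkn
  let d : Fin n → ℝ := fun j => (-1) ^ (j : ℕ)
  have hd : ∀ j, d j * d j = 1 := fun j => by
    rw [← mul_pow, neg_one_mul, neg_neg, one_pow]
  have horth : A * (diagonal d * Bᵀ) = 0 := by
    ext i l
    have hmem : B l ∈ (Submodule.span ℝ (Set.range fun i => B i) : Set (Fin n → ℝ)) :=
      Submodule.subset_span ⟨l, rfl⟩
    rw [hperp] at hmem
    rw [mul_apply, Matrix.zero_apply, ← hmem i]
    simp_rw [diagonal_mul, transpose_apply]
    exact Finset.sum_congr rfl fun j _ => by ring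
  let e₀ : Fin (n - k) ⊕ Fin k ≃ Fin n := finSumFinEquiv.trans (finCongr hmk)
  let G := fromRows (B * diagonal d) A
  let s : ℝ := ∏ i : Fin (n - k), (-1 : ℝ) ^ (i : ℕ)
  have hG : (G.submatrix id e₀).det ≠ 0 :=
    det_submatrix_fromRows_ne_zero hd A B (by simpa using hA) (by simpa using hB) horth e₀
  have hs : s ≠ 0 := Finset.prod_ne_zero_iff.2 fun i _ => pow_ne_zero _ (by norm_num)
  have hBB : (B * Bᵀ).det ≠ 0 :=
    det_mul_transpose_ne_zero_of_rank_eq_card B (by simpa using hB)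
  refine ⟨(B * Bᵀ).det / (s * (G.submatrix id e₀).det), div_ne_zero hBB (mul_ne_zero hs hG), ?_⟩
  intro J hJ
  have hJc : Jᶜ.card = k := by
    rw [Finset.card_compl, Fintype.card_fin, hJ]
    omega
  let e := finSumEquivOfFinset hJ hJc
  have hsign : ((Equiv.Perm.sign (e.trans e₀.symm) : ℤ) : ℝ) * ∏ i, d (e (Sum.inl i)) = s := by
    have h := congrArg (fun u : ℤˣ => ((u : ℤ) : ℝ)) (sign_shuffle_mul_prod hmk e
      (J.orderEmbOfFin hJ).strictMono (Jᶜ.orderEmbOfFin hJc).strictMono)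
    simpa [d, s, e₀, Units.coe_prod] using h
  have hdet : (G.submatrix id e).det =
      (Equiv.Perm.sign (e.trans e₀.symm) : ℤ) * (G.submatrix id e₀).det := by
    rw [← det_permute']
    congr 1
    ext i j
    simp
  have hA' : plucker A Jᶜ = (A.submatrix id (e ∘ Sum.inr)).det := dif_pos hJc
  have hB' : plucker B J = (B.submatrix id (e ∘ Sum.inl)).det := dif_pos hJ
  have key := det_submatrix_mul_det_of_orthogonal hd A B horth e
  rw [← hA', ← hB', hdet] at key
  rw [div_mul_eq_mul_div, eq_div_iff (mul_ne_zero hs hG), ← key, ← hsign]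
  ring
end

section
/- Let 1 ≤ k ≤ n. Let A be a real k×n matrix of rank k all of whose k×k minors are nonnegative, and let B be a real (n−k)×n matrix of rank n−k whose row space equals the ω₀-orthogonal complement {y ∈ ℝⁿ : ω₀(a, y) = 0 for every row a of A} of the row space of A. Then all (n−k)×(n−k) minors of B have the same sign: either p_J(B) ≥ 0 for every (n−k)-element subset J of {1,…,n}, or p_J(B) ≤ 0 for every such J. Hence the Hodge star map V ↦ V^⊥ restricts to a bijection between the positive Grassmannians Gr₊(k,n) and Gr₊(n−k,n). -/
open Matrix

section Shuffles

variable {k m n : ℕ}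

/-- A `(k, m)`-shuffle: a bijection from `Fin k ⊕ Fin m` which is increasing on both blocks. -/
def IsShuffle (e : Fin k ⊕ Fin m ≃ Fin n) : Prop :=
  StrictMono (fun i => e (Sum.inl i)) ∧ StrictMono (fun j => e (Sum.inr j))

lemma isShuffle_finSumEquivOfFinset {I : Finset (Fin n)} (hI : I.card = k)
    (hI' : Iᶜ.card = m) : IsShuffle (finSumEquivOfFinset hI hI') := by
  constructor
  · intro i j hij
    simpa using hij
  · intro i j hij
    simpa using hij

/-- A shuffle in which no value of the first block immediately follows a value of the second
block puts the whole first block before the second one. -/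
lemma inl_lt_inr_of_no_descent {e : Fin k ⊕ Fin m ≃ Fin n}
    (h : ∀ i j, (e (Sum.inr j) : ℕ) + 1 ≠ e (Sum.inl i)) (i : Fin k) (j : Fin m) :
    e (Sum.inl i) < e (Sum.inr j) := by
  have key : ∀ (d : ℕ) (i : Fin k) (j : Fin m),
      (e (Sum.inr j) : ℕ) + (d + 1) ≠ e (Sum.inl i) := by
    intro d
    induction d with
    | zero => exact h
    | succ d ih =>
      intro i j hij
      obtain ⟨x, hx⟩ := e.surjective ⟨(e (Sum.inr j) : ℕ) + 1, by omega⟩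
      have hx' : (e x : ℕ) = (e (Sum.inr j) : ℕ) + 1 := by rw [hx]
      rcases x with i' | j'
      · exact h i' j hx'.symm
      · exact ih i j' (by omega)
  by_contra hlt
  have hne : e (Sum.inl i) ≠ e (Sum.inr j) := fun h' => by simpa using e.injective h'
  have := key ((e (Sum.inl i) : ℕ) - e (Sum.inr j) - 1) i j
  omega

/-- There is at most one shuffle putting the first block before the second one. -/
lemma IsShuffle.eq_of_inl_lt_inr {e e' : Fin k ⊕ Fin m ≃ Fin n}
    (he : IsShuffle e) (he' : IsShuffle e')
    (h : ∀ i j, e (Sum.inl i) < e (Sum.inr j)) (h' : ∀ i j, e' (Sum.inl i) < e' (Sum.inr j)) :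
    e = e' := by
  have mono : ∀ f : Fin k ⊕ Fin m ≃ Fin n, IsShuffle f →
      (∀ i j, f (Sum.inl i) < f (Sum.inr j)) → StrictMono (f ∘ ofLex : Fin k ⊕ₗ Fin m → Fin n) := by
    rintro f ⟨hl, hr⟩ hf (a | a) (b | b) hab
    · exact hl (Sum.Lex.inl_lt_inl_iff.1 hab)
    · exact hf a b
    · exact absurd hab Sum.Lex.not_inr_lt_inl
    · exact hr (Sum.Lex.inr_lt_inr_iff.1 hab)
  have := (StrictMono.range_inj (mono e he h) (mono e' he' h')).1 (by
    rw [(e.surjective.comp ofLex.surjective).range_eq,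
      (e'.surjective.comp ofLex.surjective).range_eq])
  ext x : 1
  exact congrFun this (toLex x)

/-- Composing a shuffle with an adjacent transposition exchanging its two blocks
gives a shuffle. -/
lemma IsShuffle.trans_swap {e : Fin k ⊕ Fin m ≃ Fin n} (he : IsShuffle e) {i : Fin k} {j : Fin m}
    (hij : (e (Sum.inr j) : ℕ) + 1 = e (Sum.inl i)) :
    IsShuffle (e.trans (Equiv.swap (e (Sum.inl i)) (e (Sum.inr j)))) := by
  constructor
  · intro a b hab
    have h1 := he.1 hab
    have ha : e (Sum.inl a) ≠ e (Sum.inr j) := fun h' => by simpa using e.injective h'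
    have hb : e (Sum.inl b) ≠ e (Sum.inr j) := fun h' => by simpa using e.injective h'
    simp only [Equiv.trans_apply, Equiv.swap_apply_def]
    split_ifs <;> simp_all only [Fin.lt_def, ne_eq, Fin.ext_iff] <;> omega
  · intro a b hab
    have h1 := he.2 hab
    have ha : e (Sum.inr a) ≠ e (Sum.inl i) := fun h' => by simpa using e.injective h'
    have hb : e (Sum.inr b) ≠ e (Sum.inl i) := fun h' => by simpa using e.injective h'
    simp only [Equiv.trans_apply, Equiv.swap_apply_def]
    split_ifs <;> simp_all only [Fin.lt_def, ne_eq, Fin.ext_iff] <;> omega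

/-- The signed determinant of a matrix with rows rearranged by a shuffle. -/
noncomputable def shuffleDet {R : Type*} [CommRing R] (M : Matrix (Fin n) (Fin k ⊕ Fin m) R)
    (e : Fin k ⊕ Fin m ≃ Fin n) : R :=
  (∏ i, (-1) ^ (e (Sum.inl i) : ℕ)) * (M.submatrix e id).det

lemma shuffleDet_trans_swap {R : Type*} [CommRing R] (M : Matrix (Fin n) (Fin k ⊕ Fin m) R)
    {e : Fin k ⊕ Fin m ≃ Fin n} {i : Fin k} {j : Fin m}
    (hij : (e (Sum.inr j) : ℕ) + 1 = e (Sum.inl i)) :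
    shuffleDet M (e.trans (Equiv.swap (e (Sum.inl i)) (e (Sum.inr j)))) = shuffleDet M e := by
  have hdet : (M.submatrix (e.trans (Equiv.swap (e (Sum.inl i)) (e (Sum.inr j)))) id).det =
      -(M.submatrix e id).det := by
    have := Matrix.det_permute (Equiv.swap (Sum.inl i) (Sum.inr j)) (M.submatrix e id)
    rw [Equiv.Perm.sign_swap (by simp)] at this
    simp only [Units.val_neg, Units.val_one, Int.cast_neg, Int.cast_one, neg_mul, one_mul] at this
    rw [← this, Matrix.submatrix_submatrix]
    congr 2
    ext x : 1
    simp only [Equiv.trans_apply, Function.comp_apply]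
    exact e.injective.swap_apply _ _ _
  have hprod : ∏ a, (-1 : R) ^
        ((e.trans (Equiv.swap (e (Sum.inl i)) (e (Sum.inr j)))) (Sum.inl a) : ℕ) =
      -∏ a, (-1 : R) ^ (e (Sum.inl a) : ℕ) := by
    rw [← Finset.mul_prod_erase _ _ (Finset.mem_univ i),
      ← Finset.mul_prod_erase _ (fun a => (-1 : R) ^ (e (Sum.inl a) : ℕ)) (Finset.mem_univ i),
      ← neg_mul]
    congr 1
    · simp [← hij, pow_succ]
    · refine Finset.prod_congr rfl fun a ha => ?_
      rw [Equiv.trans_apply, Equiv.swap_apply_of_ne_of_ne]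
      · simpa using Finset.ne_of_mem_erase ha
      · simp
  rw [shuffleDet, shuffleDet, hdet, hprod, neg_mul_neg]

/-- The signed determinant is the same for all shuffles. -/
lemma IsShuffle.shuffleDet_eq {R : Type*} [CommRing R] (M : Matrix (Fin n) (Fin k ⊕ Fin m) R)
    {e e' : Fin k ⊕ Fin m ≃ Fin n} (he : IsShuffle e) (he' : IsShuffle e') :
    shuffleDet M e = shuffleDet M e' := by
  have key : ∀ (s : ℕ) (e : Fin k ⊕ Fin m ≃ Fin n), IsShuffle e →
      ∑ i, (e (Sum.inl i) : ℕ) = s → ∃ f : Fin k ⊕ Fin m ≃ Fin n, IsShuffle f ∧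
        (∀ i j, f (Sum.inl i) < f (Sum.inr j)) ∧ shuffleDet M e = shuffleDet M f := by
    intro s
    induction s using Nat.strong_induction_on with
    | _ s ih =>
      intro e he hs
      by_cases h : ∀ i j, (e (Sum.inr j) : ℕ) + 1 ≠ e (Sum.inl i)
      · exact ⟨e, he, inl_lt_inr_of_no_descent h, rfl⟩
      · push Not at h
        obtain ⟨i, j, hij⟩ := h
        have hlt : ∑ a, ((e.trans (Equiv.swap (e (Sum.inl i)) (e (Sum.inr j))))
            (Sum.inl a) : ℕ) < s := by
          rw [← hs]
          refine Finset.sum_lt_sum (fun a _ => ?_) ⟨i, Finset.mem_univ i, ?_⟩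
          · rcases eq_or_ne a i with rfl | ha
            · simp only [Equiv.trans_apply, Equiv.swap_apply_left]
              omega
            · rw [Equiv.trans_apply, Equiv.swap_apply_of_ne_of_ne (by simpa using ha) (by simp)]
          · simp only [Equiv.trans_apply, Equiv.swap_apply_left]
            omega
        obtain ⟨f, hf, hf', hdet⟩ := ih _ hlt _ (he.trans_swap hij) rfl
        exact ⟨f, hf, hf', (shuffleDet_trans_swap M hij).symm.trans hdet⟩
  obtain ⟨f, hf, hlt, h⟩ := key _ e he rfl
  obtain ⟨f', hf', hlt', h'⟩ := key _ e' he' rfl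
  rw [h, h', hf.eq_of_inl_lt_inr hf' hlt hlt']

end Shuffles

/-- Complementary minors of two `ω₀`-orthogonal matrices, up to a determinant built from
both of them. -/
lemma det_mul_plucker_compl_eq {k m n : ℕ} (A : Matrix (Fin k) (Fin n) ℝ)
    (B : Matrix (Fin m) (Fin n) ℝ)
    (hAB : A * diagonal (fun j : Fin n => (-1 : ℝ) ^ (j : ℕ)) * Bᵀ = 0)
    {I : Finset (Fin n)} (hI : I.card = k) (hI' : Iᶜ.card = m) :
    (A * Aᵀ).det * plucker B Iᶜ =
      plucker A I * shuffleDet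
        (fromCols (diagonal (fun j : Fin n => (-1 : ℝ) ^ (j : ℕ)) * Aᵀ) Bᵀ)
        (finSumEquivOfFinset hI hI') := by
  set D := diagonal (fun j : Fin n => (-1 : ℝ) ^ (j : ℕ)) with hD
  set e := finSumEquivOfFinset hI hI'
  have hDD : A * D * (D * Aᵀ) = A * Aᵀ := by
    have : D * D = 1 := by
      rw [hD, diagonal_mul_diagonal, ← diagonal_one]
      congr 1
      ext j
      rw [← mul_pow]
      simp
    rw [Matrix.mul_assoc, ← Matrix.mul_assoc D, this, Matrix.one_mul]
  set M := fromCols (D * Aᵀ) Bᵀ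
  have hM : A * D * M = fromCols (A * Aᵀ) 0 := by
    rw [mul_fromCols, hDD, hAB]
  have hprod : fromBlocks ((A * D).submatrix id (e ∘ Sum.inl)) ((A * D).submatrix id (e ∘ Sum.inr))
        0 1 * M.submatrix e id =
      fromBlocks (A * Aᵀ) 0 ((D * Aᵀ).submatrix (e ∘ Sum.inr) id)
        (Bᵀ.submatrix (e ∘ Sum.inr) id) := by
    ext (i | i) j
    · have := congrFun (congrFun hM i) j
      rw [Matrix.mul_apply, ← e.sum_comp] at this
      rw [Matrix.mul_apply]
      refine Eq.trans ?_ (this.trans ?_)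
      · simp [Fintype.sum_sum_type]
      · cases j <;> simp
    · rw [Matrix.mul_apply, Fintype.sum_sum_type]
      cases j <;> simp [Matrix.one_apply, M]
  have hdet := congrArg Matrix.det hprod
  rw [Matrix.det_mul, det_fromBlocks_zero₂₁, det_fromBlocks_zero₁₂, det_one, mul_one] at hdet
  have hB : (Bᵀ.submatrix (e ∘ Sum.inr) id).det = plucker B Iᶜ := by
    rw [plucker, dif_pos hI', ← det_transpose]
    congr 1
  have hA : ((A * D).submatrix id (e ∘ Sum.inl)).det =
      plucker A I * ∏ i, (-1 : ℝ) ^ (e (Sum.inl i) : ℕ) := by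
    rw [plucker, dif_pos hI, ← det_diagonal, ← det_mul]
    congr 1
    ext i j
    simp [hD, e]
  rw [← hB, ← hdet, hA, shuffleDet, mul_assoc]

/-- Let `A` be a real `k × n` matrix of rank `k` all of whose `k × k`
minors are nonnegative, and let `B` be a real `(n-k) × n` matrix of rank `n - k` whose
row space is the `ω₀`-orthogonal complement of the row space of `A`, where
`ω₀(x, y) = ∑ᵢ (-1)^{i-1} xᵢ yᵢ`.  Then all maximal minors of `B` have the same sign:
either `p_J(B) ≥ 0` for all `(n-k)`-sets `J`, or `p_J(B) ≤ 0` for all such `J`.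
(Hence the Hodge star map restricts to a bijection `Gr₊(k,n) → Gr₊(n-k,n)`.) -/
theorem statement14 {k n : ℕ} (hk : 1 ≤ k) (hkn : k ≤ n)
    (A : Matrix (Fin k) (Fin n) ℝ) (hA : A.rank = k)
    (hApos : ∀ I : Finset (Fin n), I.card = k → 0 ≤ plucker A I)
    (B : Matrix (Fin (n - k)) (Fin n) ℝ) (hB : B.rank = n - k)
    (hperp : (Submodule.span ℝ (Set.range fun i => B i) : Set (Fin n → ℝ)) =
      {y | ∀ i : Fin k, ∑ j : Fin n, ((-1 : ℝ) ^ (j : ℕ)) * A i j * y j = 0}) :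
    (∀ J : Finset (Fin n), J.card = n - k → 0 ≤ plucker B J) ∨
    (∀ J : Finset (Fin n), J.card = n - k → plucker B J ≤ 0) := by
  have hAB : A * diagonal (fun j : Fin n => (-1 : ℝ) ^ (j : ℕ)) * Bᵀ = 0 := by
    ext i l
    have hl : B l ∈ (Submodule.span ℝ (Set.range fun i => B i) : Set (Fin n → ℝ)) :=
      Submodule.subset_span ⟨l, rfl⟩
    rw [hperp] at hl
    rw [Matrix.mul_apply, Matrix.zero_apply, ← hl i]
    refine Finset.sum_congr rfl fun j _ => ?_
    rw [mul_diagonal, transpose_apply]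
    ring
  have hG : 0 < (A * Aᵀ).det := by
    have hli : LinearIndependent ℝ A.row := by
      rw [linearIndependent_iff_card_eq_finrank_span, Set.finrank, ← rank_eq_finrank_span_row, hA,
        Fintype.card_fin]
    have hpd := Matrix.PosDef.mul_conjTranspose_self A (vecMul_injective_iff.2 hli)
    rw [conjTranspose_eq_transpose_of_trivial] at hpd
    exact hpd.det_pos
  have hcompl : ∀ J : Finset (Fin n), J.card = n - k → Jᶜ.card = k := fun J hJ => by
    rw [Finset.card_compl, Fintype.card_fin, hJ]
    omega
  obtain ⟨c, hc⟩ : ∃ c : ℝ, ∀ J : Finset (Fin n), J.card = n - k →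
      (A * Aᵀ).det * plucker B J = plucker A Jᶜ * c := by
    obtain ⟨J₀, -, hJ₀⟩ := Finset.exists_subset_card_eq
      (show n - k ≤ (Finset.univ : Finset (Fin n)).card by simp)
    have hJ₀' : J₀ᶜᶜ.card = n - k := by rwa [compl_compl]
    refine ⟨shuffleDet
      (fromCols (diagonal (fun j : Fin n => (-1 : ℝ) ^ (j : ℕ)) * Aᵀ) Bᵀ)
      (finSumEquivOfFinset (hcompl J₀ hJ₀) hJ₀'), fun J hJ => ?_⟩
    have hJ' : Jᶜᶜ.card = n - k := by rwa [compl_compl]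
    have h := det_mul_plucker_compl_eq A B hAB (hcompl J hJ) hJ'
    rw [compl_compl] at h
    rw [h, (isShuffle_finSumEquivOfFinset _ _).shuffleDet_eq _
      (isShuffle_finSumEquivOfFinset (hcompl J₀ hJ₀) hJ₀')]
  rcases le_total 0 c with h | h
  · refine Or.inl fun J hJ => nonneg_of_mul_nonneg_right ?_ hG
    rw [hc J hJ]
    exact mul_nonneg (hApos _ (hcompl J hJ)) h
  · refine Or.inr fun J hJ => nonpos_of_mul_nonpos_right ?_ hG
    rw [hc J hJ]
    exact mul_nonpos_of_nonneg_of_nonpos (hApos _ (hcompl J hJ)) h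
end

section
/- Let k ≥ 1. Let B be a real (k+1)×(2k+2) matrix of rank k+1 with B·Ω₀⁽²ᵏ⁺²⁾·Bᵀ = 0 all of whose (k+1)×(k+1) minors are nonnegative. Then there exist a real k×(2k+1) matrix A of rank k with A·Ω₀⁽²ᵏ⁺¹⁾·Aᵀ = 0 and a nonzero real number c such that for every k-element subset I of {1,…,2k+1}, p_I(A) = c · p_{I∪{2k+2}}(B); in particular all k×k minors of A have the same sign, so A represents a point of OGr₊(k, 2k+1). -/
open Matrix

/-- The `m × m` diagonal matrix `Ω₀` of the alternating form
`ω₀(x, y) = ∑ᵢ (-1)^{i-1} xᵢ yᵢ` (zero-based: diagonal entries `(-1)^i`). -/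
def Omega0 (m : ℕ) : Matrix (Fin m) (Fin m) ℝ :=
  Matrix.diagonal fun i : Fin m => (-1 : ℝ) ^ (i : ℕ)

section OrthogonalGrassmannian

/-- Invertible linear maps act transitively on nonzero real vectors. -/
theorem exists_det_ne_zero_mulVec_eq {n : Type} [Fintype n] [DecidableEq n] {v w : n → ℝ}
    (hv : v ≠ 0) (hw : w ≠ 0) : ∃ G : Matrix n n ℝ, G.det ≠ 0 ∧ G *ᵥ v = w := by
  obtain ⟨e, he⟩ := SeparatingDual.exists_continuousLinearEquiv_apply_eq (R := ℝ) hv hw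
  refine ⟨LinearMap.toMatrix' (e.toLinearEquiv : (n → ℝ) →ₗ[ℝ] n → ℝ), ?_, ?_⟩
  · rw [LinearMap.det_toMatrix']
    exact (LinearEquiv.isUnit_det' e.toLinearEquiv).ne_zero
  · rw [LinearMap.toMatrix'_mulVec]
    exact he

/-- Deleting a zero last column does not change the rank. -/
theorem rank_submatrix_castSucc_of_last_eq_zero {F : Type} [Field F] {m n : ℕ}
    (M : Matrix (Fin m) (Fin (n + 1)) F) (h : ∀ i, M i (Fin.last n) = 0) :
    (M.submatrix id Fin.castSucc).rank = M.rank := by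
  refine le_antisymm (rank_submatrix_le _ _ _) ?_
  have hM : M = M.submatrix id Fin.castSucc *
      (1 : Matrix (Fin (n + 1)) (Fin (n + 1)) F).submatrix Fin.castSucc id := by
    ext i j
    have hs := congrFun (congrFun (Matrix.mul_one M) i) j
    rw [Matrix.mul_apply, Fin.sum_univ_castSucc, h, zero_mul, add_zero] at hs
    exact hs.symm
  conv_lhs => rw [hM]
  exact rank_mul_le_left _ _

theorem mul_Omega0_mul_transpose_apply {m n : ℕ} (M : Matrix (Fin m) (Fin n) ℝ) (i j : Fin m) :
    (M * Omega0 n * Mᵀ) i j = ∑ l, M i l * (-1) ^ (l : ℕ) * M j l := by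
  rw [Matrix.mul_apply]
  simp [Omega0, Matrix.mul_diagonal]

/-- Deleting a zero last column does not change the Gram matrix of the alternating form. -/
theorem submatrix_castSucc_mul_Omega0_mul_transpose {m n : ℕ}
    (M : Matrix (Fin m) (Fin (n + 1)) ℝ) (h : ∀ i, M i (Fin.last n) = 0) :
    M.submatrix id Fin.castSucc * Omega0 n * (M.submatrix id Fin.castSucc)ᵀ =
      M * Omega0 (n + 1) * Mᵀ := by
  ext i j
  rw [mul_Omega0_mul_transpose_apply, mul_Omega0_mul_transpose_apply, Fin.sum_univ_castSucc]
  simp [h]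

/-- A totally isotropic subspace for the alternating form has at most half the dimension. -/
theorem two_mul_rank_le_of_mul_Omega0_mul_transpose_eq_zero {m n : ℕ}
    (M : Matrix (Fin m) (Fin n) ℝ) (h : M * Omega0 n * Mᵀ = 0) : 2 * M.rank ≤ n := by
  have hdet : (Omega0 n).det ≠ 0 := by
    simp [Omega0, Matrix.det_diagonal, Finset.prod_ne_zero_iff]
  have hr := rank_add_rank_le_card_of_mul_eq_zero h
  rw [rank_transpose, rank_mul_eq_left_of_det_ne_zero _ _ hdet, Fintype.card_fin] at hr
  omega

theorem linearIndependent_row_of_rank_eq {F : Type} [Field F] {m n : ℕ}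
    (M : Matrix (Fin m) (Fin n) F) (h : M.rank = m) : LinearIndependent F M.row := by
  rw [linearIndependent_iff_card_eq_finrank_span, Fintype.card_fin, Set.finrank,
    ← rank_eq_finrank_span_row, h]

theorem plucker_mul {R : Type} [CommRing R] {k n : ℕ} (G : Matrix (Fin k) (Fin k) R)
    (M : Matrix (Fin k) (Fin n) R) (I : Finset (Fin n)) :
    plucker (G * M) I = G.det * plucker M I := by
  unfold plucker
  split_ifs with h
  · rw [← Matrix.det_mul]
    rfl
  · rw [mul_zero]

theorem orderEmbOfFin_insert_last {k n : ℕ} (I : Finset (Fin n)) (h : I.card = k)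
    (h' : (insert (Fin.last n) (I.map Fin.castSuccEmb)).card = k + 1) :
    Fin.snoc (α := fun _ => Fin (n + 1)) (fun j => (I.orderEmbOfFin h j).castSucc) (Fin.last n) =
      (insert (Fin.last n) (I.map Fin.castSuccEmb)).orderEmbOfFin h' := by
  refine Finset.orderEmbOfFin_unique h' (fun x => ?_) fun a b hab => ?_
  · induction x using Fin.lastCases with
    | last => simp
    | cast x => simp
  · induction b using Fin.lastCases with
    | last =>
      induction a using Fin.lastCases with
      | last => exact absurd hab (lt_irrefl _)
      | cast a => simp [Fin.castSucc_lt_last]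
    | cast b =>
      induction a using Fin.lastCases with
      | last => exact absurd hab (not_lt.2 (Fin.le_last _))
      | cast a => simpa using hab

/-- If the last column of `M` is the last standard basis vector, the Plücker coordinates of `M`
containing the last column are those of `M` with its last row and column removed. -/
theorem plucker_insert_last {R : Type} [CommRing R] {k n : ℕ}
    (M : Matrix (Fin (k + 1)) (Fin (n + 1)) R)
    (hM : ∀ i, M i (Fin.last n) = (Pi.single (Fin.last k) 1 : Fin (k + 1) → R) i)
    (I : Finset (Fin n)) (hI : I.card = k) :
    plucker M (insert (Fin.last n) (I.map Fin.castSuccEmb)) =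
      plucker (M.submatrix Fin.castSucc Fin.castSucc) I := by
  have hcard : (insert (Fin.last n) (I.map Fin.castSuccEmb)).card = k + 1 := by
    rw [Finset.card_insert_of_notMem (by simp), Finset.card_map, hI]
  unfold plucker
  rw [dif_pos hcard, dif_pos hI, ← orderEmbOfFin_insert_last I hI hcard,
    Matrix.det_succ_column _ (Fin.last k), Fin.sum_univ_castSucc]
  simp only [of_apply, Fin.snoc_last, hM]
  rw [Finset.sum_eq_zero fun i _ => by simp]
  rw [zero_add, Pi.single_eq_same, mul_one, Even.neg_one_pow (Even.add_self _), one_mul]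
  congr 1
  ext i j
  simp

end OrthogonalGrassmannian

/-- Let `B` be a real `(k+1) × (2k+2)` matrix of rank `k + 1` with
`B * Ω₀ * Bᵀ = 0` all of whose maximal minors are nonnegative.  Then there are a real
`k × (2k+1)` matrix `A` of rank `k` with `A * Ω₀ * Aᵀ = 0` and a nonzero real `c` such
that `p_I(A) = c · p_{I∪{2k+2}}(B)` for every `k`-element subset `I` of `{1, …, 2k+1}`;
in particular all maximal minors of `A` have the same sign, so `A` represents a point
of `OGr₊(k, 2k+1)`. -/
theorem statement15 {k : ℕ} (hk : 1 ≤ k)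
    (B : Matrix (Fin (k + 1)) (Fin (2 * k + 2)) ℝ) (hrank : B.rank = k + 1)
    (hB : B * Omega0 (2 * k + 2) * Bᵀ = 0)
    (hpos : ∀ J : Finset (Fin (2 * k + 2)), J.card = k + 1 → 0 ≤ plucker B J) :
    ∃ (A : Matrix (Fin k) (Fin (2 * k + 1)) ℝ) (c : ℝ), A.rank = k ∧
      A * Omega0 (2 * k + 1) * Aᵀ = 0 ∧ c ≠ 0 ∧
      (∀ I : Finset (Fin (2 * k + 1)), I.card = k →
        plucker A I =
          c * plucker B (insert (Fin.last (2 * k + 1)) (I.map Fin.castSuccEmb))) ∧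
      ((∀ I : Finset (Fin (2 * k + 1)), I.card = k → 0 ≤ plucker A I) ∨
       (∀ I : Finset (Fin (2 * k + 1)), I.card = k → plucker A I ≤ 0)) := by
  have hv : B.col (Fin.last (2 * k + 1)) ≠ 0 := by
    intro h0
    have h0' : ∀ i, B i (Fin.last (2 * k + 1)) = 0 := congrFun h0
    have hiso := (submatrix_castSucc_mul_Omega0_mul_transpose B h0').trans hB
    have := two_mul_rank_le_of_mul_Omega0_mul_transpose_eq_zero _ hiso
    rw [rank_submatrix_castSucc_of_last_eq_zero B h0'] at this
    omega
  obtain ⟨G, hG, hGv⟩ := exists_det_ne_zero_mulVec_eq hv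
    (w := Pi.single (Fin.last k) 1) (by simp)
  have hlast : ∀ i, (G * B) i (Fin.last (2 * k + 1)) =
      (Pi.single (Fin.last k) 1 : Fin (k + 1) → ℝ) i := congrFun hGv
  have hzero : ∀ i, ((G * B).submatrix Fin.castSucc id) i (Fin.last (2 * k + 1)) = 0 := by
    intro i
    rw [submatrix_apply, id, hlast, Pi.single_eq_of_ne (Fin.castSucc_lt_last i).ne]
  have hpl : ∀ I : Finset (Fin (2 * k + 1)), I.card = k →
      plucker ((G * B).submatrix Fin.castSucc Fin.castSucc) I =
        G.det * plucker B (insert (Fin.last (2 * k + 1)) (I.map Fin.castSuccEmb)) := by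
    intro I hI
    rw [← plucker_insert_last (G * B) hlast I hI, plucker_mul]
  have hnonneg : ∀ I : Finset (Fin (2 * k + 1)), I.card = k →
      0 ≤ plucker B (insert (Fin.last (2 * k + 1)) (I.map Fin.castSuccEmb)) := by
    intro I hI
    refine hpos _ ?_
    rw [Finset.card_insert_of_notMem (by simp), Finset.card_map, hI]
  refine ⟨(G * B).submatrix Fin.castSucc Fin.castSucc, G.det, ?_, ?_, hG, hpl, ?_⟩
  · have hrow := linearIndependent_row_of_rank_eq (G * B)
      ((rank_mul_eq_right_of_det_ne_zero _ _ hG).trans hrank)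
    have hN : LinearIndependent ℝ ((G * B).submatrix Fin.castSucc id).row :=
      hrow.comp _ (Fin.castSucc_injective k)
    have := hN.rank_matrix
    rw [← rank_submatrix_castSucc_of_last_eq_zero _ hzero, Fintype.card_fin] at this
    exact this
  · refine (submatrix_castSucc_mul_Omega0_mul_transpose _ hzero).trans ?_
    have hGB : G * B * Omega0 (2 * k + 2) * (G * B)ᵀ = 0 := by
      rw [transpose_mul, Matrix.mul_assoc G, Matrix.mul_assoc G, ← Matrix.mul_assoc _ Bᵀ, hB,
        Matrix.zero_mul, Matrix.mul_zero]
    ext i j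
    have := congrFun (congrFun hGB i.castSucc) j.castSucc
    rw [mul_Omega0_mul_transpose_apply] at this ⊢
    exact this
  · rcases le_total 0 G.det with hc | hc
    · exact Or.inl fun I hI => (hpl I hI).symm ▸ mul_nonneg hc (hnonneg I hI)
    · exact Or.inr fun I hI => (hpl I hI).symm ▸ mul_nonpos_of_nonpos_of_nonneg hc (hnonneg I hI)
end

section
/- Let 1 ≤ k ≤ n and let A be a real k×n matrix of rank k with A·Ω₀·Aᵀ = 0 all of whose k×k minors are nonnegative. For (k−1)-element subsets I, J of {1,…,n} define A⁺_{IJ} = {ℓ ∈ {1,…,n}∖(I∪J) : p_{I∪{ℓ}}(A) ≠ 0, p_{J∪{ℓ}}(A) ≠ 0, and (−1)^{ℓ−1} ε(Iℓ) ε(Jℓ) = +1} and A⁻_{IJ} = {ℓ ∈ {1,…,n}∖(I∪J) : p_{I∪{ℓ}}(A) ≠ 0, p_{J∪{ℓ}}(A) ≠ 0, and (−1)^{ℓ−1} ε(Iℓ) ε(Jℓ) = −1}. Then for every pair I, J: A⁺_{IJ} = ∅ if and only if A⁻_{IJ} = ∅. (In other words, the positroid of any point of OGr₊(k,n) is an orthopositroid.)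 -/
open Matrix

/-- The sign `ε(Iℓ) = (-1)^{#{i ∈ I : i > ℓ}}`, i.e. the sign of the permutation sorting
the string `Iℓ`. -/
def epsSign {n : ℕ} (I : Finset (Fin n)) (l : Fin n) : ℤ :=
  (-1) ^ (I.filter fun i => l < i).card

/-- The coefficients of the linear functional `v ↦ det (v | A_I)` on column vectors. -/
noncomputable def cofactorVec {m n : ℕ} (A : Matrix (Fin (m + 1)) (Fin n) ℝ)
    (I : Finset (Fin n)) (hI : I.card = m) (i : Fin (m + 1)) : ℝ :=
  (-1) ^ (i : ℕ) * (A.submatrix i.succAbove (I.orderEmbOfFin hI)).det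

theorem sum_cofactorVec_mul_of_mem {m n : ℕ} (A : Matrix (Fin (m + 1)) (Fin n) ℝ)
    (I : Finset (Fin n)) (hI : I.card = m) {l : Fin n} (hl : l ∈ I) :
    ∑ i, cofactorVec A I hI i * A i l = 0 := by
  obtain ⟨j, hj⟩ : ∃ j, I.orderEmbOfFin hI j = l := by
    have : l ∈ Set.range (I.orderEmbOfFin hI) := by simpa using hl
    exact this
  let f : Fin (m + 1) → Fin n := Fin.cons l (I.orderEmbOfFin hI)
  have h0 : (A.submatrix id f).det = 0 := by
    refine Matrix.det_zero_of_column_eq (i := 0) (j := j.succ) (Fin.succ_ne_zero j).symm ?_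
    intro i
    simp [f, hj]
  rw [Matrix.det_succ_column_zero] at h0
  rw [← h0]
  refine Finset.sum_congr rfl fun i _ => ?_
  have : (A.submatrix id f).submatrix i.succAbove Fin.succ =
      A.submatrix i.succAbove (I.orderEmbOfFin hI) := by
    ext a b
    simp [f]
  rw [this]
  simp only [cofactorVec, Matrix.submatrix_apply, id, f, Fin.cons_zero]
  ring

theorem sum_cofactorVec_mul_of_notMem {m n : ℕ} (A : Matrix (Fin (m + 1)) (Fin n) ℝ)
    (I : Finset (Fin n)) (hI : I.card = m) {l : Fin n} (hl : l ∉ I) :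
    ∑ i, cofactorVec A I hI i * A i l =
      (-1) ^ m * (epsSign I l : ℝ) * plucker A (insert l I) := by
  have hc : (insert l I).card = m + 1 := by rw [Finset.card_insert_of_notMem hl, hI]
  set g := (insert l I).orderEmbOfFin hc with hg
  have hrange : ∀ x, x ∈ insert l I ↔ ∃ j, g j = x := fun x => by
    rw [← Finset.mem_coe, ← Finset.range_orderEmbOfFin _ hc]
    rfl
  obtain ⟨p, hp⟩ := (hrange l).1 (Finset.mem_insert_self l I)
  have he : g ∘ p.succAbove = I.orderEmbOfFin hI := by
    refine Finset.orderEmbOfFin_unique hI (fun x => ?_)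
      (g.strictMono.comp (Fin.strictMono_succAbove p))
    have h1 := (hrange (g (p.succAbove x))).2 ⟨_, rfl⟩
    refine (Finset.mem_insert.1 h1).resolve_left fun h2 => ?_
    rw [← hp] at h2
    exact Fin.succAbove_ne p x (g.injective h2)
  have hcard : (I.filter fun i => l < i).card = m - p := by
    have : (I.filter fun i => l < i) = (Finset.Ioi p).map g.toEmbedding := by
      ext x
      simp only [Finset.mem_filter, Finset.mem_map, Finset.mem_Ioi, RelEmbedding.coe_toEmbedding]
      constructor
      · rintro ⟨hx, hlx⟩
        obtain ⟨j, rfl⟩ := (hrange x).1 (Finset.mem_insert_of_mem hx)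
        rw [← hp] at hlx
        exact ⟨j, g.lt_iff_lt.1 hlx, rfl⟩
      · rintro ⟨j, hj, rfl⟩
        have hlt : l < g j := hp ▸ g.lt_iff_lt.2 hj
        exact ⟨(Finset.mem_insert.1 ((hrange (g j)).2 ⟨j, rfl⟩)).resolve_left hlt.ne', hlt⟩
    rw [this, Finset.card_map, Fin.card_Ioi]
    omega
  have hpl : plucker A (insert l I) = (A.submatrix id g).det := by
    rw [plucker, dif_pos hc]
    rfl
  have hsign : ((-1 : ℝ)) ^ m * (-1) ^ (m - (p : ℕ)) = (-1) ^ (p : ℕ) := by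
    obtain ⟨q, hq⟩ := Nat.exists_eq_add_of_le (Nat.lt_succ_iff.1 p.2)
    rw [show m - (p : ℕ) = q by omega, ← pow_add,
      show m + q = p + 2 * q by omega, pow_add, pow_mul]
    simp
  rw [hpl, epsSign, hcard]
  push_cast
  rw [hsign, Matrix.det_succ_column _ p, Finset.mul_sum]
  refine Finset.sum_congr rfl fun i _ => ?_
  have : (A.submatrix id g).submatrix i.succAbove p.succAbove =
      A.submatrix i.succAbove (I.orderEmbOfFin hI) := by
    rw [Matrix.submatrix_submatrix, he]
    rfl
  have hpp : ((-1 : ℝ)) ^ (p : ℕ) * (-1) ^ (p : ℕ) = 1 := by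
    rw [← mul_pow]
    simp
  rw [this, Matrix.submatrix_apply, hp, cofactorVec, pow_add, id]
  linear_combination
    -((-1 : ℝ) ^ (i : ℕ) * A i l * (A.submatrix i.succAbove (I.orderEmbOfFin hI)).det) * hpp

/-- The orthogonality relations between Plücker coordinates of an isotropic subspace. -/
theorem sum_plucker_mul_plucker_eq_zero {m n : ℕ} (A : Matrix (Fin (m + 1)) (Fin n) ℝ)
    (hA : A * Matrix.diagonal (fun i : Fin n => (-1 : ℝ) ^ (i : ℕ)) * Aᵀ = 0)
    (I J : Finset (Fin n)) (hI : I.card = m) (hJ : J.card = m) :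
    ∑ l ∈ (I ∪ J)ᶜ, (((-1 : ℤ) ^ (l : ℕ) * epsSign I l * epsSign J l : ℤ) : ℝ) *
      (plucker A (insert l I) * plucker A (insert l J)) = 0 := by
  have key : ∑ l : Fin n, (-1 : ℝ) ^ (l : ℕ) * ((∑ i, cofactorVec A I hI i * A i l) *
      (∑ j, cofactorVec A J hJ j * A j l)) = 0 := by
    have h : cofactorVec A I hI ⬝ᵥ
        ((A * Matrix.diagonal (fun i : Fin n => (-1 : ℝ) ^ (i : ℕ)) * Aᵀ) *ᵥ
          cofactorVec A J hJ) = 0 := by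
      rw [hA]
      simp
    rw [← Matrix.mulVec_mulVec, ← Matrix.mulVec_mulVec, Matrix.dotProduct_mulVec,
      Matrix.mulVec_transpose] at h
    rw [← h, dotProduct]
    refine Finset.sum_congr rfl fun l _ => ?_
    rw [Matrix.mulVec_diagonal]
    simp only [Matrix.vecMul, dotProduct]
    ring
  rw [← key]
  refine Finset.sum_subset_zero_on_sdiff (Finset.subset_univ _) (fun l hl => ?_) fun l hl => ?_
  · have hl' : l ∈ I ∨ l ∈ J := by simpa [-not_or, or_iff_not_imp_left] using hl
    rcases hl' with h | h
    · rw [sum_cofactorVec_mul_of_mem A I hI h]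
      ring
    · rw [sum_cofactorVec_mul_of_mem A J hJ h]
      ring
  · have hl' : l ∉ I ∧ l ∉ J := by simpa using hl
    rw [sum_cofactorVec_mul_of_notMem A I hI hl'.1, sum_cofactorVec_mul_of_notMem A J hJ hl'.2]
    have hmm : ((-1 : ℝ)) ^ m * (-1) ^ m = 1 := by
      rw [← mul_pow]
      simp
    push_cast
    linear_combination -((-1 : ℝ) ^ (l : ℕ) * epsSign I l * epsSign J l *
      (plucker A (insert l I) * plucker A (insert l J))) * hmm

theorem exists_sign_neg_of_sum_eq_zero {ι : Type*} (s : Finset ι) (σ : ι → ℤ) (x y : ι → ℝ)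
    (hσ : ∀ l ∈ s, σ l = 1 ∨ σ l = -1) (hx : ∀ l ∈ s, 0 ≤ x l) (hy : ∀ l ∈ s, 0 ≤ y l)
    (hsum : ∑ l ∈ s, (σ l : ℝ) * (x l * y l) = 0)
    (h : ∃ l ∈ s, x l ≠ 0 ∧ y l ≠ 0 ∧ σ l = 1) :
    ∃ l ∈ s, x l ≠ 0 ∧ y l ≠ 0 ∧ σ l = -1 := by
  by_contra! hne
  obtain ⟨l, hl, hxl, hyl, hsl⟩ := h
  have hnonneg : ∀ i ∈ s, 0 ≤ (σ i : ℝ) * (x i * y i) := fun i hi => by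
    by_cases hxi : x i = 0
    · simp [hxi]
    by_cases hyi : y i = 0
    · simp [hyi]
    rw [(hσ i hi).resolve_right (hne i hi hxi hyi)]
    simpa using mul_nonneg (hx i hi) (hy i hi)
  have h0 := (Finset.sum_eq_zero_iff_of_nonneg hnonneg).1 hsum l hl
  simp [hsl, hxl, hyl] at h0

/-- Let `A` be a real `k × n` matrix of rank `k` with
`A * Ω₀ * Aᵀ = 0` (where `Ω₀` is the diagonal matrix of the alternating form) all of
whose maximal minors are nonnegative.  Then for all `(k-1)`-subsets `I, J`, the set
`A⁺_{IJ}` of indices `ℓ ∉ I ∪ J` with `p_{I∪{ℓ}}(A) ≠ 0`, `p_{J∪{ℓ}}(A) ≠ 0` and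
`(-1)^{ℓ-1} ε(Iℓ) ε(Jℓ) = +1` is empty if and only if the analogous set `A⁻_{IJ}`
(with sign `-1`) is empty; i.e. the positroid of a point of `OGr₊(k,n)` is an
orthopositroid. -/
theorem statement17 {k n : ℕ} (hk : 1 ≤ k) (hkn : k ≤ n)
    (A : Matrix (Fin k) (Fin n) ℝ) (hrank : A.rank = k)
    (hA : A * Matrix.diagonal (fun i : Fin n => (-1 : ℝ) ^ (i : ℕ)) * Aᵀ = 0)
    (hpos : ∀ I : Finset (Fin n), I.card = k → 0 ≤ plucker A I)
    (I J : Finset (Fin n)) (hI : I.card = k - 1) (hJ : J.card = k - 1) :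
    ((∃ l ∈ (I ∪ J)ᶜ, plucker A (insert l I) ≠ 0 ∧ plucker A (insert l J) ≠ 0 ∧
        (-1 : ℤ) ^ (l : ℕ) * epsSign I l * epsSign J l = 1) ↔
      (∃ l ∈ (I ∪ J)ᶜ, plucker A (insert l I) ≠ 0 ∧ plucker A (insert l J) ≠ 0 ∧
        (-1 : ℤ) ^ (l : ℕ) * epsSign I l * epsSign J l = -1)) := by
  obtain ⟨m, rfl⟩ : ∃ m, k = m + 1 := ⟨k - 1, by omega⟩
  rw [Nat.add_sub_cancel] at hI hJ
  have hsum := sum_plucker_mul_plucker_eq_zero A hA I J hI hJ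
  have hσ : ∀ l ∈ (I ∪ J)ᶜ, (-1 : ℤ) ^ (l : ℕ) * epsSign I l * epsSign J l = 1 ∨
      (-1 : ℤ) ^ (l : ℕ) * epsSign I l * epsSign J l = -1 := fun l _ => by
    rw [epsSign, epsSign, ← pow_add, ← pow_add]
    exact neg_one_pow_eq_or ℤ _
  have hnonneg : ∀ K : Finset (Fin n), 0 ≤ plucker A K := fun K => by
    by_cases hK : K.card = m + 1
    · exact hpos K hK
    · rw [plucker, dif_neg hK]
  constructor
  · exact exists_sign_neg_of_sum_eq_zero _ _ _ _ hσ (fun _ _ => hnonneg _)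
      (fun _ _ => hnonneg _) hsum
  · intro h
    have := exists_sign_neg_of_sum_eq_zero (I ∪ J)ᶜ
      (fun l => -((-1 : ℤ) ^ (l : ℕ) * epsSign I l * epsSign J l))
      (fun l => plucker A (insert l I)) (fun l => plucker A (insert l J))
      (fun l hl => (hσ l hl).symm.imp (fun h => by rw [h]; rfl) (fun h => by rw [h]))
      (fun _ _ => hnonneg _) (fun _ _ => hnonneg _)
      (by
        simp only [Int.cast_neg, neg_mul, Finset.sum_neg_distrib]
        rw [neg_eq_zero]
        simpa using hsum)
      (by simpa only [neg_eq_iff_eq_neg] using h)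
    simpa only [neg_inj] using this
end

section
/- Let ω be the split bilinear form on ℝ⁴ given by ω(x,y) = x₁y₁ + x₂y₂ − x₃y₃ − x₄y₄. If V is a 2-dimensional subspace of ℝ⁴ that is totally isotropic with respect to ω and all Plücker coordinates of V have the same sign (i.e. for some, equivalently any, 2×4 matrix whose rows form a basis of V, the six 2×2 minors are all nonnegative or all nonpositive), then V is the span of the vectors (1,0,0,−1) and (0,1,1,0). In particular the Plücker-positive region OGr₊^ω(2,4) consists of a single point. -/
open Matrix

theorem plucker_pair {R : Type} [CommRing R] {n : ℕ} (A : Matrix (Fin 2) (Fin n) R)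
    {i j : Fin n} (hij : i < j) :
    plucker A {i, j} = A 0 i * A 1 j - A 0 j * A 1 i := by
  have hcard : ({i, j} : Finset (Fin n)).card = 2 := Finset.card_pair hij.ne
  have hemb : ![i, j] = ({i, j} : Finset (Fin n)).orderEmbOfFin hcard := by
    refine Finset.orderEmbOfFin_unique hcard ?_ ?_
    · intro x
      fin_cases x <;> simp
    · intro x y hxy
      fin_cases x <;> fin_cases y <;> simp_all
  rw [plucker, dif_pos hcard, ← hemb, Matrix.det_fin_two]
  simp

/-- The rotation `R` with rows `(a, b)`, `(c, d)` for which `[1 | R]` has nonnegative minors. -/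
theorem eq_of_orthogonal_of_minors_nonneg {a b c d : ℝ} (hab : a * a + b * b = 1)
    (hcd : c * c + d * d = 1) (hac : a * c + b * d = 0) (ha : a ≤ 0) (hb : b ≤ 0)
    (hc : 0 ≤ c) (hd : 0 ≤ d) (hdet : 0 ≤ a * d - b * c) :
    a = 0 ∧ b = -1 ∧ c = 1 ∧ d = 0 := by
  have hac0 : a * c = 0 := by nlinarith
  have hbd0 : b * d = 0 := by nlinarith
  have ha0 : a = 0 := by
    by_contra h
    have hc0 : c = 0 := (mul_eq_zero.mp hac0).resolve_left h
    have hd1 : d = 1 := by subst hc0; nlinarith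
    subst hc0 hd1
    exact h (by linarith)
  subst ha0
  have hb1 : b = -1 := by nlinarith
  subst hb1
  have hd0 : d = 0 := by linarith
  subst hd0
  exact ⟨rfl, rfl, by nlinarith, rfl⟩

/-- A vector of a totally isotropic subspace of the split form is determined by its first
two coordinates. -/
theorem eq_zero_of_isotropic {V : Submodule ℝ (Fin 4 → ℝ)}
    (hiso : ∀ x ∈ V, ∀ y ∈ V, x 0 * y 0 + x 1 * y 1 - x 2 * y 2 - x 3 * y 3 = 0)
    {x : Fin 4 → ℝ} (hx : x ∈ V) (h0 : x 0 = 0) (h1 : x 1 = 0) : x = 0 := by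
  have h := hiso x hx x hx
  rw [h0, h1] at h
  have h2 : x 2 = 0 := by nlinarith [mul_self_nonneg (x 2), mul_self_nonneg (x 3)]
  have h3 : x 3 = 0 := by nlinarith [mul_self_nonneg (x 2), mul_self_nonneg (x 3)]
  funext i
  fin_cases i <;> assumption

/-- The minor on the first two columns does not vanish on a totally isotropic plane. -/
theorem minor_ne_zero_of_isotropic {V : Submodule ℝ (Fin 4 → ℝ)}
    (hiso : ∀ x ∈ V, ∀ y ∈ V, x 0 * y 0 + x 1 * y 1 - x 2 * y 2 - x 3 * y 3 = 0)
    {u v : Fin 4 → ℝ} (hu : u ∈ V) (hv : v ∈ V) (hli : LinearIndependent ℝ ![u, v]) :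
    u 0 * v 1 - u 1 * v 0 ≠ 0 := by
  intro he
  rw [LinearIndependent.pair_iff] at hli
  have key : ∀ s t : ℝ, s * u 0 + t * v 0 = 0 → s * u 1 + t * v 1 = 0 → s = 0 ∧ t = 0 :=
    fun s t h0 h1 => hli s t <| eq_zero_of_isotropic hiso
      (V.add_mem (V.smul_mem s hu) (V.smul_mem t hv)) (by simpa using h0) (by simpa using h1)
  have h1 := key (v 1) (-u 1) (by linarith) (by ring)
  have h0 := key (v 0) (-u 0) (by ring) (by linarith)
  have := key 1 0 (by linarith) (by linarith)
  exact one_ne_zero this.1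

/-- For the split bilinear form
`ω(x, y) = x₁y₁ + x₂y₂ - x₃y₃ - x₄y₄` on `ℝ⁴`, if `V` is a `2`-dimensional totally
isotropic subspace all of whose Plücker coordinates have the same sign (for a matrix
whose rows form a basis of `V`, the six `2 × 2` minors are all nonnegative or all
nonpositive), then `V` is the span of `(1,0,0,-1)` and `(0,1,1,0)`.  In particular the
Plücker-positive region `OGr₊^ω(2,4)` is a single point. -/
theorem statement19 (V : Submodule ℝ (Fin 4 → ℝ))
    (hdim : Module.finrank ℝ V = 2)
    (hiso : ∀ x ∈ V, ∀ y ∈ V, x 0 * y 0 + x 1 * y 1 - x 2 * y 2 - x 3 * y 3 = 0)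
    (hpos : ∃ M : Matrix (Fin 2) (Fin 4) ℝ,
      LinearIndependent ℝ (fun i : Fin 2 => M i) ∧
      Submodule.span ℝ (Set.range fun i : Fin 2 => M i) = V ∧
      ((∀ I : Finset (Fin 4), I.card = 2 → 0 ≤ plucker M I) ∨
       (∀ I : Finset (Fin 4), I.card = 2 → plucker M I ≤ 0))) :
    V = Submodule.span ℝ
      ({![1, 0, 0, -1], ![0, 1, 1, 0]} : Set (Fin 4 → ℝ)) := by
  obtain ⟨M, hli, hspan, hsign⟩ := hpos
  have hM : ∀ i, M i ∈ V := fun i => hspan ▸ Submodule.subset_span ⟨i, rfl⟩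
  have hli' : LinearIndependent ℝ ![M 0, M 1] := by
    convert hli using 1
    funext i
    fin_cases i <;> rfl
  set e := M 0 0 * M 1 1 - M 0 1 * M 1 0 with he
  have he0 : e ≠ 0 := minor_ne_zero_of_isotropic hiso (hM 0) (hM 1) hli'
  have hminor : ∀ i j : Fin 4, i < j → 0 ≤ (M 0 i * M 1 j - M 0 j * M 1 i) / e := by
    intro i j hij
    have h01 : (0 : Fin 4) < 1 := by decide
    rw [← plucker_pair M hij, he, ← plucker_pair M h01]
    rcases hsign with h | h
    · exact div_nonneg (h _ (Finset.card_pair hij.ne)) (h _ (Finset.card_pair h01.ne))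
    · exact div_nonneg_of_nonpos (h _ (Finset.card_pair hij.ne)) (h _ (Finset.card_pair h01.ne))
  obtain ⟨f, hf⟩ : ∃ f, f = (M 1 1 / e) • M 0 - (M 0 1 / e) • M 1 := ⟨_, rfl⟩
  obtain ⟨g, hg⟩ : ∃ g, g = (M 0 0 / e) • M 1 - (M 1 0 / e) • M 0 := ⟨_, rfl⟩
  have hfV : f ∈ V := hf ▸ V.sub_mem (V.smul_mem _ (hM 0)) (V.smul_mem _ (hM 1))
  have hgV : g ∈ V := hg ▸ V.sub_mem (V.smul_mem _ (hM 1)) (V.smul_mem _ (hM 0))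
  have hfi : ∀ i, f i = (M 0 i * M 1 1 - M 0 1 * M 1 i) / e := fun i => by
    simp only [hf, Pi.sub_apply, Pi.smul_apply, smul_eq_mul]
    ring
  have hgi : ∀ i, g i = (M 0 0 * M 1 i - M 0 i * M 1 0) / e := fun i => by
    simp only [hg, Pi.sub_apply, Pi.smul_apply, smul_eq_mul]
    ring
  have hf0 : f 0 = 1 := by rw [hfi, ← he, div_self he0]
  have hf1 : f 1 = 0 := by rw [hfi, sub_self, zero_div]
  have hg0 : g 0 = 0 := by rw [hgi, sub_self, zero_div]
  have hg1 : g 1 = 1 := by rw [hgi, ← he, div_self he0]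
  have hff := hiso f hfV f hfV
  have hgg := hiso g hgV g hgV
  have hfg := hiso f hfV g hgV
  rw [hf0, hf1] at hff hfg
  rw [hg0, hg1] at hgg hfg
  have hneg : ∀ i, 1 < i → f i ≤ 0 := fun i hi => by
    have h := hminor 1 i hi
    rw [hfi, ← neg_nonneg, ← neg_div, neg_sub]
    exact h
  have hpos : ∀ i, 0 < i → 0 ≤ g i := fun i hi => hgi i ▸ hminor 0 i hi
  have hdet : f 2 * g 3 - f 3 * g 2 = (M 0 2 * M 1 3 - M 0 3 * M 1 2) / e := by
    simp only [hfi, hgi]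
    field_simp
    rw [he]
    ring
  obtain ⟨hf2, hf3, hg2, hg3⟩ := eq_of_orthogonal_of_minors_nonneg
    (a := f 2) (b := f 3) (c := g 2) (d := g 3) (by linarith) (by linarith) (by linarith)
    (hneg 2 (by decide)) (hneg 3 (by decide)) (hpos 2 (by decide)) (hpos 3 (by decide))
    (hdet ▸ hminor 2 3 (by decide))
  have hf_eq : f = ![1, 0, 0, -1] := by
    funext i
    fin_cases i <;> assumption
  have hg_eq : g = ![0, 1, 1, 0] := by
    funext i
    fin_cases i <;> assumption
  rw [← hf_eq, ← hg_eq]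
  apply le_antisymm
  · intro x hx
    have hx0 : x - (x 0 • f + x 1 • g) = 0 := eq_zero_of_isotropic hiso
      (V.sub_mem hx (V.add_mem (V.smul_mem _ hfV) (V.smul_mem _ hgV)))
      (by simp [hf0, hg0]) (by simp [hf1, hg1])
    exact Submodule.mem_span_pair.mpr ⟨x 0, x 1, (sub_eq_zero.mp hx0).symm⟩
  · exact Submodule.span_le.mpr (Set.pair_subset hfV hgV)
end
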